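/- arXiv:2003.06578 — 2 statements merged into one kernel-verified Lean document; each statement's English description precedes it below -/
import Mathlib

section
/- Let $R>0$, $\mu>0$. With $(h_1,p_1)$ as defined in the context, let $\mathcal{I}_1=\int_{\partial D_2}e_x\cdot\sigma[h_1,p_1]\nu\,dl$ and $\mathcal{J}_1=\int_{\partial D_2}U_{\mathrm{ex}}\cdot\sigma[h_1,p_1]\nu\,dl$, where $U_{\mathrm{ex}}(x,y)=(x,-y)$. Then $\mathcal{I}_1=-4\pi\mu/(2s-\tanh 2s)$, and there exist constants $C>0$ and $\delta_0>0$ depending only on $R$ and $\mu$ such that for all $0<\delta<\delta_0$: $\big|\mathcal{I}_1+\tfrac{3\pi\mu}{2}(R/\delta)^{3/2}\big|\le C\delta^{-1/2}$ and $|\mathcal{J}_1+3\pi\mu R|\le C\delta$. -/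
open Real MeasureTheory Matrix

noncomputable section

namespace StokesPaper

/-- Points in the plane. -/
abbrev Pt := ℝ × ℝ

/-- Partial derivative in the `x`-direction. -/
def pdx (f : Pt → ℝ) (z : Pt) : ℝ := fderiv ℝ f z (1, 0)

/-- Partial derivative in the `y`-direction. -/
def pdy (f : Pt → ℝ) (z : Pt) : ℝ := fderiv ℝ f z (0, 1)

/-- Gradient matrix of a vector field: `(∇u)ᵢⱼ = ∂ⱼ uᵢ`. -/
def grad (u : Pt → Pt) (z : Pt) : Matrix (Fin 2) (Fin 2) ℝ :=
  !![pdx (fun w => (u w).1) z, pdy (fun w => (u w).1) z;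
     pdx (fun w => (u w).2) z, pdy (fun w => (u w).2) z]

/-- Strain tensor `E[u] = (∇u + ∇uᵀ)/2`. -/
def strain (u : Pt → Pt) (z : Pt) : Matrix (Fin 2) (Fin 2) ℝ :=
  (2⁻¹ : ℝ) • (grad u z + (grad u z)ᵀ)

/-- Stress tensor `σ[u,p] = -p I + 2 μ E[u]`. -/
def stress (μ : ℝ) (u : Pt → Pt) (p : Pt → ℝ) (z : Pt) : Matrix (Fin 2) (Fin 2) ℝ :=
  (-(p z)) • (1 : Matrix (Fin 2) (Fin 2) ℝ) + (2 * μ) • strain u z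

/-- Laplacian of a scalar function. -/
def lap (f : Pt → ℝ) (z : Pt) : ℝ := pdx (pdx f) z + pdy (pdy f) z

/-- Divergence of a vector field. -/
def divg (u : Pt → Pt) (z : Pt) : ℝ :=
  pdx (fun w => (u w).1) z + pdy (fun w => (u w).2) z

/-- A norm on 2×2 matrices (sum of absolute values of the entries). -/
def matNorm (M : Matrix (Fin 2) (Fin 2) ℝ) : ℝ :=
  |M 0 0| + |M 0 1| + |M 1 0| + |M 1 1|

/-- Matrix-vector multiplication. -/
def matVec (M : Matrix (Fin 2) (Fin 2) ℝ) (v : Pt) : Pt :=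
  (M 0 0 * v.1 + M 0 1 * v.2, M 1 0 * v.1 + M 1 1 * v.2)

/-- Euclidean dot product on the plane. -/
def dot (v w : Pt) : ℝ := v.1 * w.1 + v.2 * w.2

/-- Center of the left disk. -/
def ctr1 (R δ : ℝ) : Pt := (-R - δ / 2, 0)

/-- Center of the right disk. -/
def ctr2 (R δ : ℝ) : Pt := (R + δ / 2, 0)

def D1 (R δ : ℝ) : Set Pt := Metric.ball (ctr1 R δ) R
def D2 (R δ : ℝ) : Set Pt := Metric.ball (ctr2 R δ) R

/-- The exterior domain `Dᵉ = ℝ² \ closure (D₁ ∪ D₂)`. -/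
def De (R δ : ℝ) : Set Pt := (closure (D1 R δ ∪ D2 R δ))ᶜ

def bd1 (R δ : ℝ) : Set Pt := Metric.sphere (ctr1 R δ) R
def bd2 (R δ : ℝ) : Set Pt := Metric.sphere (ctr2 R δ) R

/-- The rigid motions `ψ₁, ψ₂, ψ₃`. -/
def ψ1 : Pt → Pt := fun _ => (1, 0)
def ψ2 : Pt → Pt := fun _ => (0, 1)
def ψ3 : Pt → Pt := fun z => (z.2, -z.1)

def ψv : Fin 3 → Pt → Pt := ![ψ1, ψ2, ψ3]

/-- The class `M`: `u(x) = C + O(|x|⁻¹)`, `∇u(x) = O(|x|⁻²)`, `p(x) = O(|x|⁻²)` as `|x| → ∞`. -/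
def MemM (u : Pt → Pt) (p : Pt → ℝ) : Prop :=
  ∃ C0 : Pt, ∃ K r : ℝ, ∀ z : Pt, r ≤ ‖z‖ →
    ‖u z - C0‖ ≤ K / ‖z‖ ∧ ‖fderiv ℝ u z‖ ≤ K / ‖z‖ ^ 2 ∧ |p z| ≤ K / ‖z‖ ^ 2

/-- The class `M₀`: as `M` but with `C = 0`. -/
def MemM0 (u : Pt → Pt) (p : Pt → ℝ) : Prop :=
  ∃ K r : ℝ, ∀ z : Pt, r ≤ ‖z‖ →
    ‖u z‖ ≤ K / ‖z‖ ∧ ‖fderiv ℝ u z‖ ≤ K / ‖z‖ ^ 2 ∧ |p z| ≤ K / ‖z‖ ^ 2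

/-- The Stokes system `μ Δu = ∇p`, `∇·u = 0` in `Dᵉ`. -/
def StokesPDE (R δ μ : ℝ) (u : Pt → Pt) (p : Pt → ℝ) : Prop :=
  ∀ z ∈ De R δ,
    μ * lap (fun w => (u w).1) z = pdx p z ∧
    μ * lap (fun w => (u w).2) z = pdy p z ∧
    divg u z = 0

/-- Smoothness of `(u,p)` up to the boundary of the exterior domain. -/
def SmoothNearClosure (R δ : ℝ) (u : Pt → Pt) (p : Pt → ℝ) : Prop :=
  ∃ V : Set Pt, IsOpen V ∧ closure (De R δ) ⊆ V ∧
    ContDiffOn ℝ (⊤ : ℕ∞) u V ∧ ContDiffOn ℝ (⊤ : ℕ∞) p V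

/-- The boundary integral `∫ F · σ[u,p] ν dl` over the circle of radius `R` centered at `c`,
with `ν` the outward (with respect to the disk) unit normal. -/
def bdryInt (R : ℝ) (c : Pt) (μ : ℝ) (u : Pt → Pt) (p : Pt → ℝ) (F : Pt → Pt) : ℝ :=
  ∫ t in (0 : ℝ)..(2 * π),
    (dot (F (c.1 + R * Real.cos t, c.2 + R * Real.sin t))
      (matVec (stress μ u p (c.1 + R * Real.cos t, c.2 + R * Real.sin t))
        (Real.cos t, Real.sin t))) * R

/-- The equilibrium conditions `∫_{∂Dᵢ} ψⱼ · σ[u,p] ν dl = 0`. -/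
def Equilibrium (R δ μ : ℝ) (u : Pt → Pt) (p : Pt → ℝ) : Prop :=
  ∀ j : Fin 3,
    bdryInt R (ctr1 R δ) μ u p (ψv j) = 0 ∧ bdryInt R (ctr2 R δ) μ u p (ψv j) = 0

/-- `(u,p)` is the solution of the exterior Stokes problem with background field `U`
and boundary constants `cc`. -/
def IsExtSolution (R δ μ : ℝ) (U : Pt → Pt) (u : Pt → Pt) (p : Pt → ℝ)
    (cc : Fin 2 → Fin 3 → ℝ) : Prop :=
  SmoothNearClosure R δ u p ∧ StokesPDE R δ μ u p ∧
  (∀ z ∈ bd1 R δ, u z = cc 0 0 • ψv 0 z + cc 0 1 • ψv 1 z + cc 0 2 • ψv 2 z) ∧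
  (∀ z ∈ bd2 R δ, u z = cc 1 0 • ψv 0 z + cc 1 1 • ψv 1 z + cc 1 2 • ψv 2 z) ∧
  Equilibrium R δ μ u p ∧
  MemM0 (fun z => u z - U z) p

/-- The extensional background flow `U_ex(x,y) = (x,-y)`. -/
def Uex : Pt → Pt := fun z => (z.1, -z.2)

/-- The shear background flow `U_sh(x,y) = (y,x)`. -/
def Ush : Pt → Pt := fun z => (z.2, z.1)

/-- The narrow region `Π_δ`. -/
def narrow (R δ : ℝ) : Set Pt :=
  {z : Pt | -R - δ / 2 ≤ z.1 ∧ z.1 ≤ R + δ / 2 ∧ |z.2| ≤ Real.sqrt δ} ∩ De R δ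
/-- The bipolar parameter `a = √(δ(R + δ/4))`. -/
def aa (R δ : ℝ) : ℝ := Real.sqrt (δ * (R + δ / 4))

/-- `s = arcsinh(a/R)`, so that `∂D₁ = {ζ = -s}` and `∂D₂ = {ζ = s}`. -/
def ss (R δ : ℝ) : ℝ := Real.arsinh (aa R δ / R)

/-- The argument of a point of the plane. -/
def argPt (v : Pt) : ℝ := Complex.arg ⟨v.1, v.2⟩

/-- The bipolar coordinate `ζ`. -/
def zeta (R δ : ℝ) (z : Pt) : ℝ :=
  Real.log (Real.sqrt ((z.1 + aa R δ) ^ 2 + z.2 ^ 2) /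
    Real.sqrt ((z.1 - aa R δ) ^ 2 + z.2 ^ 2))

/-- The bipolar coordinate `θ`. -/
def theta (R δ : ℝ) (z : Pt) : ℝ :=
  argPt (z.1 - aa R δ, z.2) - argPt (z.1 + aa R δ, z.2)

def alphaB (ζ θ : ℝ) : ℝ := (1 - Real.cosh ζ * Real.cos θ) / (Real.cosh ζ - Real.cos θ)

def betaB (ζ θ : ℝ) : ℝ := Real.sinh ζ * Real.sin θ / (Real.cosh ζ - Real.cos θ)

def A1 (R δ : ℝ) : ℝ := 1 / (2 * ss R δ - Real.tanh (2 * ss R δ))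

def B1 (R δ : ℝ) : ℝ := -A1 R δ / (2 * Real.cosh (2 * ss R δ))

/-- The singular velocity field `h₁ = h₁ζ e_ζ + h₁θ e_θ`. -/
def h1 (R δ : ℝ) (z : Pt) : Pt :=
  let ζ := zeta R δ z
  let θ := theta R δ z
  let hz := (A1 R δ * ζ + B1 R δ * Real.sinh (2 * ζ)) * alphaB ζ θ
  let ht := Real.sin θ * (A1 R δ + 2 * B1 R δ * Real.cosh (2 * ζ) -
      Real.sinh ζ * (A1 R δ * ζ + B1 R δ * Real.sinh (2 * ζ)) /
        (Real.cosh ζ - Real.cos θ))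
  hz • ((alphaB ζ θ, -betaB ζ θ) : Pt) + ht • ((-betaB ζ θ, -alphaB ζ θ) : Pt)

/-- The singular pressure `p₁`. -/
def p1 (R δ μ : ℝ) (z : Pt) : ℝ :=
  let ζ := zeta R δ z
  let θ := theta R δ z
  (2 * μ / aa R δ) * ((A1 R δ - 2 * B1 R δ) * Real.cosh ζ * Real.cos θ +
      B1 R δ * Real.cosh (2 * ζ) * Real.cos (2 * θ)) -
    (2 * μ / aa R δ) * (A1 R δ - B1 R δ)

section Aux

def Pf (a : ℝ) (z : Pt) : ℝ := (z.1 + a) ^ 2 + z.2 ^ 2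
def Qf (a : ℝ) (z : Pt) : ℝ := (z.1 - a) ^ 2 + z.2 ^ 2
def qf (a : ℝ) (z : Pt) : ℝ := Pf a z / Qf a z

lemma bip (R δ : ℝ) (z : Pt) (ha : 0 < aa R δ) (hP : 0 < Pf (aa R δ) z)
    (hQ : 0 < Qf (aa R δ) z) :
    ∃ r : ℝ, 0 < r ∧ r ^ 2 = Pf (aa R δ) z * Qf (aa R δ) z ∧
      cosh (zeta R δ z) = (Pf (aa R δ) z + Qf (aa R δ) z) / (2 * r) ∧
      sinh (zeta R δ z) = (Pf (aa R δ) z - Qf (aa R δ) z) / (2 * r) ∧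
      cos (theta R δ z) = (z.1 ^ 2 + z.2 ^ 2 - aa R δ ^ 2) / r ∧
      sin (theta R δ z) = (2 * aa R δ * z.2) / r ∧
      zeta R δ z = 1 / 2 * Real.log (qf (aa R δ) z) := by
  set a := aa R δ with hadef
  have h1 : 0 < √(Pf a z) := Real.sqrt_pos.2 hP
  have h2 : 0 < √(Qf a z) := Real.sqrt_pos.2 hQ
  have s1 : √(Pf a z) ^ 2 = Pf a z := Real.sq_sqrt hP.le
  have s2 : √(Qf a z) ^ 2 = Qf a z := Real.sq_sqrt hQ.le
  have hz : zeta R δ z = Real.log (√(Pf a z) / √(Qf a z)) := rfl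
  have n1 : ‖(⟨z.1 + a, z.2⟩ : ℂ)‖ = √(Pf a z) := by
    rw [Complex.norm_def, Complex.normSq_mk]; congr 1; unfold Pf; ring
  have n2 : ‖(⟨z.1 - a, z.2⟩ : ℂ)‖ = √(Qf a z) := by
    rw [Complex.norm_def, Complex.normSq_mk]; congr 1; unfold Qf; ring
  have e1 : (⟨z.1 + a, z.2⟩ : ℂ) ≠ 0 := by
    rw [← norm_pos_iff, n1]; exact h1
  have e2 : (⟨z.1 - a, z.2⟩ : ℂ) ≠ 0 := by
    rw [← norm_pos_iff, n2]; exact h2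
  have ht : theta R δ z = Complex.arg ⟨z.1 - a, z.2⟩ - Complex.arg ⟨z.1 + a, z.2⟩ := rfl
  refine ⟨√(Pf a z) * √(Qf a z), by positivity, by rw [mul_pow, s1, s2], ?_, ?_, ?_, ?_, ?_⟩
  · rw [hz, Real.cosh_log (by positivity)]
    field_simp
    rw [s1, s2]
  · rw [hz, Real.sinh_log (by positivity)]
    field_simp
    rw [s1, s2]
  · rw [ht, Real.cos_sub, Complex.cos_arg e1, Complex.cos_arg e2, Complex.sin_arg, Complex.sin_arg,
      n1, n2]
    field_simp
    ring
  · rw [ht, Real.sin_sub, Complex.cos_arg e1, Complex.cos_arg e2, Complex.sin_arg, Complex.sin_arg,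
      n1, n2]
    field_simp
    ring
  · rw [hz, qf, Real.log_div h1.ne' h2.ne', Real.log_div hP.ne' hQ.ne',
      Real.log_sqrt hP.le, Real.log_sqrt hQ.le]
    ring

def Phi (A B q : ℝ) : ℝ := A / 2 * Real.log q + B / 2 * (q - q⁻¹)
def gam (A B q : ℝ) : ℝ := A + B * (q + q⁻¹)
def bf (a : ℝ) (z : Pt) : ℝ := 4 * a * z.1 * z.2 ^ 2 / (Pf a z * Qf a z)
def ef (a : ℝ) (z : Pt) : ℝ := 2 * a * z.2 * (z.2 ^ 2 - z.1 ^ 2 + a ^ 2) / (Pf a z * Qf a z)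

lemma h1_formula (R δ : ℝ) (z : Pt) (ha : 0 < aa R δ) (hP : 0 < Pf (aa R δ) z)
    (hQ : 0 < Qf (aa R δ) z) :
    (h1 R δ z).1 = Phi (A1 R δ) (B1 R δ) (qf (aa R δ) z) -
        bf (aa R δ) z * gam (A1 R δ) (B1 R δ) (qf (aa R δ) z) ∧
    (h1 R δ z).2 = - (ef (aa R δ) z * gam (A1 R δ) (B1 R δ) (qf (aa R δ) z)) := by
  obtain ⟨r, hr, hr2, hch, hsh, hc, hs, hz⟩ := bip R δ z ha hP hQ
  set a := aa R δ
  set A := A1 R δ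
  set B := B1 R δ
  have hD : cosh (zeta R δ z) - cos (theta R δ z) = 2 * a ^ 2 / r := by
    rw [hch, hc]; unfold Pf Qf; field_simp; ring
  have hal : alphaB (zeta R δ z) (theta R δ z) = (z.2 ^ 2 - z.1 ^ 2 + a ^ 2) / r := by
    unfold alphaB
    rw [hD, hch, hc]
    field_simp
    rw [hr2]; unfold Pf Qf; ring
  have hbe : betaB (zeta R δ z) (theta R δ z) = 2 * z.1 * z.2 / r := by
    unfold betaB
    rw [hD, hsh, hs]
    unfold Pf Qf
    field_simp
    ring
  have hab : ((z.2 ^ 2 - z.1 ^ 2 + a ^ 2) / r) ^ 2 + (2 * z.1 * z.2 / r) ^ 2 = 1 := by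
    field_simp
    rw [hr2]; unfold Pf Qf; ring
  have hG : A * zeta R δ z + B * sinh (2 * zeta R δ z) = Phi A B (qf a z) := by
    rw [Real.sinh_two_mul, hch, hsh, hz]
    have : (2 * ((Pf a z - Qf a z) / (2 * r)) * ((Pf a z + Qf a z) / (2 * r)))
        = (Pf a z ^ 2 - Qf a z ^ 2) / (2 * r ^ 2) := by field_simp; ring
    rw [this, hr2]
    unfold Phi qf
    field_simp
  have hG' : A + 2 * B * cosh (2 * zeta R δ z) = gam A B (qf a z) := by
    rw [Real.cosh_two_mul, hch, hsh]
    have : (((Pf a z + Qf a z) / (2 * r)) ^ 2 + ((Pf a z - Qf a z) / (2 * r)) ^ 2)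
        = (Pf a z ^ 2 + Qf a z ^ 2) / (2 * r ^ 2) := by field_simp; ring
    rw [this, hr2]
    unfold gam qf
    field_simp
  have hb : bf a z = 2 * z.1 * z.2 / r * (2 * a * z.2 / r) := by
    unfold bf; rw [← hr2]; field_simp; ring
  have he : ef a z = (z.2 ^ 2 - z.1 ^ 2 + a ^ 2) / r * (2 * a * z.2 / r) := by
    unfold ef; rw [← hr2]; field_simp
  have hq : sin (theta R δ z) * (sinh (zeta R δ z) * Phi A B (qf a z) / (2 * a ^ 2 / r))
      = 2 * z.1 * z.2 / r * Phi A B (qf a z) := by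
    rw [hs, hsh]; unfold Pf Qf; field_simp; ring
  have key : ∀ X Y : ℝ, sin (theta R δ z) * (X - Y) = sin (theta R δ z) * X - sin (theta R δ z) * Y :=
    fun X Y => by ring
  constructor
  · simp only [h1, Prod.fst_add, Prod.smul_fst, smul_eq_mul]
    rw [hG, hG', hD, hal, hbe, key, hq, hs, hb]
    linear_combination (Phi A B (qf a z)) * hab
  · simp only [h1, Prod.snd_add, Prod.smul_snd, smul_eq_mul]
    rw [hG, hG', hD, hal, hbe, key, hq, hs, he]
    ring

lemma Pf_diff (a : ℝ) (z : Pt) : HasFDerivAt (Pf a)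
    ((2 * (z.1 + a)) • ContinuousLinearMap.fst ℝ ℝ ℝ + (2 * z.2) • ContinuousLinearMap.snd ℝ ℝ ℝ) z := by
  unfold Pf
  have h1 : HasFDerivAt (fun z : Pt => z.1) (ContinuousLinearMap.fst ℝ ℝ ℝ) z := hasFDerivAt_fst
  have h2 : HasFDerivAt (fun z : Pt => z.2) (ContinuousLinearMap.snd ℝ ℝ ℝ) z := hasFDerivAt_snd
  refine HasFDerivAt.congr_fderiv (((h1.add_const a).pow 2).add (h2.pow 2)) ?_
  ext <;> simp <;> ring

lemma Qf_diff (a : ℝ) (z : Pt) : HasFDerivAt (Qf a)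
    ((2 * (z.1 - a)) • ContinuousLinearMap.fst ℝ ℝ ℝ + (2 * z.2) • ContinuousLinearMap.snd ℝ ℝ ℝ) z := by
  unfold Qf
  have h1 : HasFDerivAt (fun z : Pt => z.1) (ContinuousLinearMap.fst ℝ ℝ ℝ) z := hasFDerivAt_fst
  have h2 : HasFDerivAt (fun z : Pt => z.2) (ContinuousLinearMap.snd ℝ ℝ ℝ) z := hasFDerivAt_snd
  refine HasFDerivAt.congr_fderiv (((h1.sub_const a).pow 2).add (h2.pow 2)) ?_
  ext <;> simp

lemma qf_diff (a : ℝ) (z : Pt) (hQ : 0 < Qf a z) : ∃ q' : Pt →L[ℝ] ℝ, HasFDerivAt (qf a) q' z ∧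
    q' (1, 0) = 2 * (a * (Pf a z + Qf a z) - z.1 * (Pf a z - Qf a z)) / Qf a z ^ 2 ∧
    q' (0, 1) = 2 * z.2 * (Qf a z - Pf a z) / Qf a z ^ 2 := by
  have hi := (hasDerivAt_inv hQ.ne').comp_hasFDerivAt z (Qf_diff a z)
  have hm := (Pf_diff a z).mul hi
  have he : qf a = Pf a * ((fun y : ℝ => y⁻¹) ∘ Qf a) := by
    funext w; simp [qf, div_eq_mul_inv]
  refine ⟨_, he ▸ hm, ?_, ?_⟩
  · simp; field_simp; ring
  · simp; field_simp; ring

/-- Derivative of `h1` where `gam` vanishes. -/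
lemma h1_fderiv (R δ : ℝ) (z : Pt) (ha : 0 < aa R δ) (hP : 0 < Pf (aa R δ) z)
    (hQ : 0 < Qf (aa R δ) z) (hg : gam (A1 R δ) (B1 R δ) (qf (aa R δ) z) = 0)
    (q' : Pt →L[ℝ] ℝ) (hq' : HasFDerivAt (qf (aa R δ)) q' z) :
    fderiv ℝ (fun w => (h1 R δ w).1) z =
      (-(bf (aa R δ) z * (B1 R δ * (1 - (qf (aa R δ) z ^ 2)⁻¹)))) • q' ∧
    fderiv ℝ (fun w => (h1 R δ w).2) z =
      (-(ef (aa R δ) z * (B1 R δ * (1 - (qf (aa R δ) z ^ 2)⁻¹)))) • q' := by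
  set a := aa R δ
  set A := A1 R δ
  set B := B1 R δ
  have hqp : 0 < qf a z := div_pos hP hQ
  have evP : ∀ᶠ w in nhds z, 0 < Pf a w := (Pf_diff a z).continuousAt.eventually (lt_mem_nhds hP)
  have evQ : ∀ᶠ w in nhds z, 0 < Qf a w := (Qf_diff a z).continuousAt.eventually (lt_mem_nhds hQ)
  have dP := (Pf_diff a z).differentiableAt
  have dQ := (Qf_diff a z).differentiableAt
  have hPQ : Pf a z * Qf a z ≠ 0 := by positivity
  have db : DifferentiableAt ℝ (bf a) z := by
    unfold bf
    have dn : DifferentiableAt ℝ (fun z : Pt => 4 * a * z.1 * z.2 ^ 2) z := by fun_prop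
    simp only [div_eq_mul_inv]
    exact dn.mul (DifferentiableAt.inv (dP.mul dQ) hPQ)
  have de : DifferentiableAt ℝ (ef a) z := by
    unfold ef
    have dn : DifferentiableAt ℝ (fun z : Pt => 2 * a * z.2 * (z.2 ^ 2 - z.1 ^ 2 + a ^ 2)) z := by
      fun_prop
    simp only [div_eq_mul_inv]
    exact dn.mul (DifferentiableAt.inv (dP.mul dQ) hPQ)
  have hinv : HasDerivAt (fun q : ℝ => q⁻¹) (-(qf a z ^ 2)⁻¹) (qf a z) := hasDerivAt_inv hqp.ne'
  have dgam : HasDerivAt (gam A B) (B * (1 - (qf a z ^ 2)⁻¹)) (qf a z) := by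
    unfold gam
    refine HasDerivAt.congr_deriv ((((hasDerivAt_id (qf a z)).add hinv).const_mul B).const_add A) ?_
    ring
  have dPhi : HasDerivAt (Phi A B) 0 (qf a z) := by
    unfold Phi
    refine HasDerivAt.congr_deriv (((Real.hasDerivAt_log hqp.ne').const_mul (A / 2)).add
      (((hasDerivAt_id (qf a z)).sub hinv).const_mul (B / 2))) ?_
    unfold gam at hg
    have : (qf a z)⁻¹ / 2 * (A + B * (qf a z + (qf a z)⁻¹)) = 0 := by rw [hg]; ring
    rw [← this]
    field_simp
    ring
  have c1 := dgam.comp_hasFDerivAt z hq'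
  have c2 := dPhi.comp_hasFDerivAt z hq'
  have hg0 : (gam A B ∘ qf a) z = 0 := hg
  constructor
  · have F := c2.sub (db.hasFDerivAt.mul c1)
    have ev : (fun w => (h1 R δ w).1) =ᶠ[nhds z] ((Phi A B ∘ qf a) - (bf a * (gam A B ∘ qf a))) := by
      filter_upwards [evP, evQ] with w h1 h2
      exact (h1_formula R δ w ha h1 h2).1
    rw [(F.congr_of_eventuallyEq ev).fderiv, hg0]
    ext <;> simp <;> ring
  · have F := (de.hasFDerivAt.mul c1).neg
    have ev : (fun w => (h1 R δ w).2) =ᶠ[nhds z] (- (ef a * (gam A B ∘ qf a))) := by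
      filter_upwards [evP, evQ] with w h1 h2
      exact (h1_formula R δ w ha h1 h2).2
    rw [(F.congr_of_eventuallyEq ev).fderiv, hg0]
    ext <;> simp <;> ring

lemma ss_facts (R δ : ℝ) (hR : 0 < R) (hδ : 0 < δ) :
    0 < aa R δ ∧ aa R δ = R * sinh (ss R δ) ∧ R + δ / 2 = R * cosh (ss R δ) ∧
      0 < sinh (ss R δ) ∧ 0 < ss R δ := by
  have ha : 0 < aa R δ := Real.sqrt_pos.2 (by positivity)
  have hS : sinh (ss R δ) = aa R δ / R := Real.sinh_arsinh _
  have hS0 : 0 < sinh (ss R δ) := by rw [hS]; positivity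
  have ha2 : aa R δ ^ 2 = δ * (R + δ / 4) := Real.sq_sqrt (by positivity)
  refine ⟨ha, by rw [hS]; field_simp, ?_, hS0, Real.sinh_pos_iff.1 hS0⟩
  have h := Real.cosh_sq (ss R δ)
  have hC := Real.cosh_pos (ss R δ)
  have : (R * cosh (ss R δ)) ^ 2 = (R + δ / 2) ^ 2 := by
    rw [mul_pow, h, hS, div_pow, ha2]; field_simp; ring
  exact ((sq_eq_sq₀ (by positivity) (by positivity)).1 this).symm

def pval (R μ A C S t : ℝ) : ℝ :=
  2 * μ * A * S ^ 3 / R * (2 * C / ((2 * C ^ 2 - 1) * (C + cos t)) - 1 / (C + cos t) ^ 2)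

def kval (R A C S t : ℝ) : ℝ :=
  -(4 * A * S ^ 3 * C / ((2 * C ^ 2 - 1) * R) / (C + cos t) / (C + cos t)) * sin t

lemma circle_vals (R δ μ t : ℝ) (hR : 0 < R) (hδ : 0 < δ) (z : Pt)
    (hz : z = (R + δ / 2 + R * cos t, R * sin t)) :
    p1 R δ μ z = pval R μ (A1 R δ) (cosh (ss R δ)) (sinh (ss R δ)) t ∧
    pdx (fun w => (h1 R δ w).1) z =
      kval R (A1 R δ) (cosh (ss R δ)) (sinh (ss R δ)) t * sin t * cos t ∧
    pdy (fun w => (h1 R δ w).1) z =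
      kval R (A1 R δ) (cosh (ss R δ)) (sinh (ss R δ)) t * sin t * sin t ∧
    pdx (fun w => (h1 R δ w).2) z =
      - kval R (A1 R δ) (cosh (ss R δ)) (sinh (ss R δ)) t * cos t * cos t ∧
    pdy (fun w => (h1 R δ w).2) z =
      - kval R (A1 R δ) (cosh (ss R δ)) (sinh (ss R δ)) t * cos t * sin t := by
  obtain ⟨ha, haS, hc, hS, hs⟩ := ss_facts R δ hR hδ
  have hB : B1 R δ = - A1 R δ / (2 * (2 * cosh (ss R δ) ^ 2 - 1)) := by
    unfold B1; rw [Real.cosh_two_mul, Real.sinh_sq]; ring_nf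
  have hCS := Real.cosh_sq (ss R δ)
  have hlt := Real.sinh_lt_cosh (ss R δ)
  have hC1 : 1 < cosh (ss R δ) := Real.one_lt_cosh.2 hs.ne'
  rw [hc] at hz
  set A := A1 R δ
  set C := cosh (ss R δ)
  set S := sinh (ss R δ)
  have hm : 0 < 2 * C ^ 2 - 1 := by nlinarith
  have hD : 0 < C + cos t := by linarith [Real.neg_one_le_cos t]
  have hx : z.1 = R * (C + cos t) := by rw [hz]; ring
  have hy : z.2 = R * sin t := by rw [hz]
  have hsc := Real.sin_sq_add_cos_sq t
  have hs2 : sin t ^ 2 = 1 - cos t ^ 2 := by linarith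
  have hPe : Pf (aa R δ) z = 2 * R ^ 2 * (C + cos t) * (C + S) := by
    unfold Pf; rw [hx, hy, haS]
    linear_combination (R ^ 2) * hsc - R ^ 2 * hCS
  have hQe : Qf (aa R δ) z = 2 * R ^ 2 * (C + cos t) * (C - S) := by
    unfold Qf; rw [hx, hy, haS]
    linear_combination (R ^ 2) * hsc - R ^ 2 * hCS
  have hmS : 0 < C - S := by linarith
  have hpS : 0 < C + S := by linarith
  have hP : 0 < Pf (aa R δ) z := by rw [hPe]; positivity
  have hQ : 0 < Qf (aa R δ) z := by rw [hQe]; positivity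
  have hinv : (C + S) * (C - S) = 1 := by linear_combination hCS
  have hinv' : (C + S)⁻¹ = C - S := by rw [inv_eq_iff_eq_inv]; exact eq_inv_of_mul_eq_one_left hinv
  have hq : qf (aa R δ) z = (C + S) ^ 2 := by
    unfold qf; rw [hPe, hQe]; 
    rw [div_eq_iff (by positivity)]
    linear_combination (-(2 * R ^ 2 * (C + cos t) * (C + S))) * hinv
  have hqi : ((C + S) ^ 2)⁻¹ = (C - S) ^ 2 := by rw [← inv_pow, hinv']
  have hPQ : Pf (aa R δ) z * Qf (aa R δ) z = 4 * R ^ 4 * (C + cos t) ^ 2 := by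
    rw [hPe, hQe]
    linear_combination (4 * R ^ 4 * (C + cos t) ^ 2) * hinv
  have hg : gam (A1 R δ) (B1 R δ) (qf (aa R δ) z) = 0 := by
    unfold gam
    rw [hq, hqi, hB]
    have : (C + S) ^ 2 + (C - S) ^ 2 = 2 * (2 * C ^ 2 - 1) := by linear_combination (-2) * hCS
    rw [this]; field_simp; change A + -A = 0; ring
  have hbv : bf (aa R δ) z = S * sin t ^ 2 / (C + cos t) := by
    unfold bf; rw [hPQ, hx, hy, haS]; field_simp
  have hev : ef (aa R δ) z = - (S * sin t * cos t) / (C + cos t) := by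
    unfold ef; rw [hPQ, hx, hy, haS]
    have : (R * sin t) ^ 2 - (R * (C + cos t)) ^ 2 + (R * S) ^ 2 = -2 * R ^ 2 * cos t * (C + cos t) := by
      linear_combination R ^ 2 * hsc - R ^ 2 * hCS
    rw [this]; field_simp; ring
  have hqi2 : (C + S) ^ 2 = ((C - S) ^ 2)⁻¹ := by rw [← hqi, inv_inv]
  obtain ⟨q', hq', hqx, hqy⟩ := qf_diff (aa R δ) z hQ
  obtain ⟨f1, f2⟩ := h1_fderiv R δ z ha hP hQ hg q' hq'
  have hqx' : q' (1, 0) = - (2 * S * (C + S) ^ 2 / (R * (C + cos t))) * cos t := by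
    rw [hqx, hPe, hQe, hx, haS, hqi2]
    field_simp
    ring
  have hqy' : q' (0, 1) = - (2 * S * (C + S) ^ 2 / (R * (C + cos t))) * sin t := by
    rw [hqy, hPe, hQe, hy, hqi2]
    field_simp
    ring
  have hk : B1 R δ * (1 - (qf (aa R δ) z ^ 2)⁻¹) * (2 * S * (C + S) ^ 2 / (R * (C + cos t)))
      = -(4 * A * S ^ 2 * C / ((2 * C ^ 2 - 1) * R) / (C + cos t)) := by
    have h4 : (1 - (qf (aa R δ) z ^ 2)⁻¹) * (C + S) ^ 2 = 4 * S * C := by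
      rw [hq, ← inv_pow, hqi]
      linear_combination (-(C-S)^2 * ((C + S) * (C - S) + 1)) * hinv
    calc _ = B1 R δ * ((1 - (qf (aa R δ) z ^ 2)⁻¹) * (C + S) ^ 2) * (2 * S / (R * (C + cos t))) := by ring
      _ = _ := by rw [h4, hB]; field_simp; try ring
  refine ⟨?_, ?_, ?_, ?_, ?_⟩
  · obtain ⟨r, hr, hr2, hch, hsh, hcc, hss, hzz⟩ := bip R δ z ha hP hQ
    have hrv : r = 2 * R ^ 2 * (C + cos t) := by
      rw [hPQ] at hr2
      refine (sq_eq_sq₀ hr.le (by positivity)).1 ?_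
      rw [hr2]; ring
    have e1 : cosh (zeta R δ z) = C := by
      rw [hch, hPe, hQe, hrv]; field_simp; ring
    have e2 : cos (theta R δ z) = C - S ^ 2 / (C + cos t) := by
      rw [hcc, hrv, hx, hy, haS]; field_simp
      linear_combination hsc - hCS
    simp only [p1]
    rw [Real.cosh_two_mul, Real.cos_two_mul, Real.sinh_sq, e1, e2, hB, haS]
    unfold pval
    have hS2 : S ^ 2 = C ^ 2 - 1 := by linarith
    have : S ^ 3 = S ^ 4 / S := by field_simp
    rw [this, show S ^ 4 = (S ^ 2) ^ 2 by ring, hS2]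
    change 2 * μ / (R * S) * ((A - 2 * (-A / _)) * _ * _ + -A / _ * _ * _) - 2 * μ / (R * S) * (A - -A / _) = _
    field_simp
    ring
  · rw [pdx, f1]
    simp only [_root_.smul_apply, smul_eq_mul, hqx', hbv]
    unfold kval
    linear_combination (S * sin t ^ 2 / (C + cos t) * cos t) * hk
  · rw [pdy, f1]
    simp only [_root_.smul_apply, smul_eq_mul, hqy', hbv]
    unfold kval
    linear_combination (S * sin t ^ 2 / (C + cos t) * sin t) * hk
  · rw [pdx, f2]
    simp only [_root_.smul_apply, smul_eq_mul, hqx', hev]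
    unfold kval
    linear_combination (-(S * sin t * cos t) / (C + cos t) * cos t) * hk
  · rw [pdy, f2]
    simp only [_root_.smul_apply, smul_eq_mul, hqy', hev]
    unfold kval
    linear_combination (-(S * sin t * cos t) / (C + cos t) * sin t) * hk

lemma tanh_bounds (u : ℝ) (h0 : 0 ≤ u) (h1 : u ≤ 1) :
    tanh u ≤ u ∧ u - u ^ 3 / 3 ≤ tanh u ∧ tanh u ≤ u - u ^ 3 / 3 + 2 * u ^ 5 / 15 := by
  have hd : ∀ x : ℝ, HasDerivAt tanh (1 - tanh x ^ 2) x := by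
    intro x
    have hc := (Real.cosh_pos x).ne'
    have hfun : tanh = fun x => sinh x / cosh x := by funext y; exact Real.tanh_eq_sinh_div_cosh y
    have := (Real.hasDerivAt_sinh x).div (Real.hasDerivAt_cosh x) hc
    rw [hfun]
    refine HasDerivAt.congr_deriv this ?_
    field_simp
  have h_nn : ∀ x : ℝ, 0 ≤ x → 0 ≤ tanh x := by
    intro x hx
    rw [Real.tanh_eq_sinh_div_cosh]
    exact div_nonneg (Real.sinh_nonneg_iff.2 hx) (Real.cosh_pos x).le
  have gen : ∀ (f f' : ℝ → ℝ), (∀ x, HasDerivAt f (f' x) x) → f 0 = 0 →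
      (∀ x, 0 ≤ x → x ≤ 1 → 0 ≤ f' x) → ∀ x, 0 ≤ x → x ≤ 1 → 0 ≤ f x := by
    intro f f' hf hf0 hpos x hx hx1
    have hmono : MonotoneOn f (Set.Icc 0 1) := by
      refine monotoneOn_of_deriv_nonneg (convex_Icc 0 1)
        (fun y _ => (hf y).continuousAt.continuousWithinAt)
        (fun y _ => (hf y).differentiableAt.differentiableWithinAt) ?_
      intro y hy
      rw [interior_Icc] at hy
      rw [(hf y).deriv]
      exact hpos y hy.1.le hy.2.le
    have := hmono (Set.left_mem_Icc.2 zero_le_one) (Set.mem_Icc.2 ⟨hx, hx1⟩) hx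
    linarith
  have t0 : tanh 0 = 0 := Real.tanh_zero
  have b1 : ∀ x : ℝ, 0 ≤ x → x ≤ 1 → tanh x ≤ x := by
    intro x hx hx1
    have := gen (fun x => x - tanh x) (fun x => 1 - (1 - tanh x ^ 2))
      (fun x => (hasDerivAt_id x).sub (hd x)) (by simp) (fun x _ _ => by nlinarith [sq_nonneg (tanh x)]) x hx hx1
    linarith
  have b2 : ∀ x : ℝ, 0 ≤ x → x ≤ 1 → x - x ^ 3 / 3 ≤ tanh x := by
    intro x hx hx1
    have := gen (fun x => tanh x - (x - x ^ 3 / 3)) (fun x => (1 - tanh x ^ 2) - (1 - x ^ 2))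
      (fun x => (hd x).sub (((hasDerivAt_id x).sub (((hasDerivAt_pow 3 x).div_const 3))).congr_deriv
        (by norm_num))) (by simp) (fun x h h' => by
          have := b1 x h h'
          have := h_nn x h
          nlinarith) x hx hx1
    linarith
  have b3 : ∀ x : ℝ, 0 ≤ x → x ≤ 1 → tanh x ≤ x - x ^ 3 / 3 + 2 * x ^ 5 / 15 := by
    intro x hx hx1
    have := gen (fun x => (x - x ^ 3 / 3 + 2 * x ^ 5 / 15) - tanh x)
      (fun x => (1 - x ^ 2 + 2 * x ^ 4 / 3) - (1 - tanh x ^ 2))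
      (fun x => ((((hasDerivAt_id x).sub ((hasDerivAt_pow 3 x).div_const 3)).add
        (((hasDerivAt_pow 5 x).const_mul 2).div_const 15)).congr_deriv
        (by norm_num; ring)).sub (hd x)) (by simp) (fun x h h' => by
          have h2 := b2 x h h'
          have h3 : 0 ≤ x - x ^ 3 / 3 := by
            have : x ^ 3 ≤ x := by
              calc x ^ 3 ≤ x ^ 1 := pow_le_pow_of_le_one h h' (by norm_num)
                _ = x := pow_one x
            linarith
          have h4 : (x - x ^ 3 / 3) ^ 2 ≤ tanh x ^ 2 := pow_le_pow_left₀ h3 h2 2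
          have h5 : 0 ≤ x ^ 6 := by positivity
          nlinarith) x hx hx1
    linarith
  exact ⟨b1 u h0 h1, b2 u h0 h1, b3 u h0 h1⟩

lemma cosh_bound (u : ℝ) (h0 : 0 ≤ u) (h1 : u ≤ 1) : cosh u ≤ 1 + u ^ 2 := by
  have h := Real.cosh_le_exp_half_sq u
  have h2 : |u ^ 2 / 2| = u ^ 2 / 2 := abs_of_nonneg (by positivity)
  have h3 := Real.abs_exp_sub_one_le (x := u ^ 2 / 2) (by rw [h2]; nlinarith)
  rw [h2] at h3
  have := (abs_le.1 h3).2
  linarith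

lemma sinh_bound (u : ℝ) (h0 : 0 ≤ u) (h1 : u ≤ 1) : u ≤ sinh u ∧ sinh u ≤ u + u ^ 3 := by
  refine ⟨Real.self_le_sinh_iff.2 h0, ?_⟩
  have h := (tanh_bounds u h0 h1).1
  rw [Real.tanh_eq_sinh_div_cosh, div_le_iff₀ (Real.cosh_pos u)] at h
  nlinarith [mul_le_mul_of_nonneg_left (cosh_bound u h0 h1) h0]

/-- core numerical estimates -/
lemma core (s w T S m : ℝ) (hs : 0 < s) (hs1 : s ≤ 1 / 2) (hw : s ≤ w) (hw2 : w ≤ s + s ^ 3 / 4)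
    (hT : 8 / 3 * s ^ 3 - 64 / 15 * s ^ 5 ≤ T) (hT2 : T ≤ 8 / 3 * s ^ 3)
    (hS : s ≤ S) (hS2 : S ≤ s + s ^ 3) (hm : 1 ≤ m) (hm2 : m ≤ 1 + 4 * s ^ 2) :
    0 < T ∧ |1 / T - 3 / 8 * (1 / w ^ 3)| ≤ 4 / w ∧ |8 * S ^ 3 / (T * m) - 3| ≤ 69 * w ^ 2 := by
  have hw0 : 0 < w := by linarith
  have hs2 : s ^ 2 ≤ 1 / 4 := by nlinarith
  have hTs : s ^ 3 ≤ T := by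
    have : s ^ 5 ≤ s ^ 3 * (1 / 4) := by
      rw [show s ^ 5 = s ^ 3 * s ^ 2 by ring]
      exact mul_le_mul_of_nonneg_left hs2 (by positivity)
    have : 0 < s ^ 3 := by positivity
    linarith
  have hT0 : 0 < T := lt_of_lt_of_le (by positivity) hTs
  have cube : ∀ x : ℝ, 0 ≤ x → x ≤ 1 → (1 + x) ^ 3 ≤ 1 + 7 * x := by
    intro x h h1
    have a1 : x ^ 2 ≤ x := by nlinarith
    have a2 : x ^ 3 ≤ x := by nlinarith
    nlinarith
  have w3l : s ^ 3 ≤ w ^ 3 := pow_le_pow_left₀ hs.le hw 3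
  have w3u : w ^ 3 ≤ s ^ 3 + 7 / 4 * s ^ 5 := by
    have h1 : w ^ 3 ≤ (s + s ^ 3 / 4) ^ 3 := pow_le_pow_left₀ hw0.le hw2 3
    have h2 := mul_le_mul_of_nonneg_left (cube (s ^ 2 / 4) (by positivity) (by linarith))
      (show 0 ≤ s ^ 3 by positivity)
    nlinarith
  have S3l : s ^ 3 ≤ S ^ 3 := pow_le_pow_left₀ hs.le hS 3
  have S3u : S ^ 3 ≤ s ^ 3 + 7 * s ^ 5 := by
    have h1 : S ^ 3 ≤ (s + s ^ 3) ^ 3 := pow_le_pow_left₀ (by linarith) hS2 3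
    have h2 := mul_le_mul_of_nonneg_left (cube (s ^ 2) (by positivity) (by linarith))
      (show 0 ≤ s ^ 3 by positivity)
    nlinarith
  have s5 : 0 < s ^ 5 := by positivity
  refine ⟨hT0, ?_, ?_⟩
  · have e : 1 / T - 3 / 8 * (1 / w ^ 3) = (8 * w ^ 3 - 3 * T) / (8 * w ^ 3 * T) := by
      field_simp
    rw [e, abs_of_nonneg (div_nonneg (by linarith) (by positivity)), div_le_div_iff₀ (by positivity) hw0]
    have h1 : (8 * w ^ 3 - 3 * T) * w ≤ 27 * s ^ 5 * w :=
      mul_le_mul_of_nonneg_right (by linarith) hw0.le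
    have h2 : s ^ 5 * w ≤ w ^ 3 * T := by
      calc s ^ 5 * w = (s ^ 2 * w) * s ^ 3 := by ring
        _ ≤ (w ^ 2 * w) * T := by gcongr
        _ = w ^ 3 * T := by ring
    have : 0 < w ^ 3 * T := by positivity
    linarith
  · have hTm : s ^ 3 ≤ T * m := by nlinarith
    have hm0 : 0 < m := by linarith
    have e : 8 * S ^ 3 / (T * m) - 3 = (8 * S ^ 3 - 3 * (T * m)) / (T * m) := by
      field_simp
    rw [e, abs_div, abs_of_pos (show 0 < T * m by positivity), div_le_iff₀ (by positivity)]
    have hTl : T ≤ T * m := le_mul_of_one_le_right hT0.le hm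
    have hTu : T * m ≤ 8 / 3 * s ^ 3 * (1 + 4 * s ^ 2) := by gcongr
    have hN : |8 * S ^ 3 - 3 * (T * m)| ≤ 69 * s ^ 5 := by
      rw [abs_le]; constructor <;> nlinarith
    calc _ ≤ 69 * s ^ 5 := hN
      _ = 69 * s ^ 2 * s ^ 3 := by ring
      _ ≤ 69 * w ^ 2 * (T * m) := by gcongr

lemma ftc (f F : ℝ → ℝ) (hF : ∀ t, HasDerivAt F (f t) t) (hf : Continuous f) :
    ∫ t in (0 : ℝ)..(2 * π), f t = F (2 * π) - F 0 :=
  intervalIntegral.integral_eq_sub_of_hasDerivAt (fun t _ => hF t) (hf.intervalIntegrable _ _)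

lemma ints (C S κ : ℝ) (hC : 1 < C) (hS : 0 < S) (hCS : C ^ 2 = S ^ 2 + 1) :
    (∫ t in (0 : ℝ)..(2 * π), (-κ * (cos t * (C + cos t)⁻¹ + sin t ^ 2 * ((C + cos t)⁻¹) ^ 2)
        + 2 * cos t * ((C + cos t)⁻¹) ^ 2)) = -4 * π / S ^ 3 ∧
    (∫ t in (0 : ℝ)..(2 * π), (-κ * (cos t + sin t ^ 2 * cos t * ((C + cos t)⁻¹) ^ 2)
        + 2 * cos t * (C + cos t)⁻¹ - 2 * sin t ^ 2 * ((C + cos t)⁻¹) ^ 2)) =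
      2 * π * κ * (C - S) ^ 2 / S - 8 * π * (C - S) / S := by
  have hD : ∀ t, 0 < C + cos t := fun t => by linarith [Real.neg_one_le_cos t]
  have hE : ∀ t, 0 < C + S + cos t := fun t => by linarith [hD t]
  have hv : Continuous fun t => (C + cos t)⁻¹ :=
    Continuous.inv₀ (by fun_prop) (fun t => (hD t).ne')
  have dD : ∀ t, HasDerivAt (fun t => C + cos t) (-sin t) t := fun t =>
    (Real.hasDerivAt_cos t).const_add C
  have dE : ∀ t, HasDerivAt (fun t => C + S + cos t) (-sin t) t := fun t =>
    (Real.hasDerivAt_cos t).const_add (C + S)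
  have dZ : ∀ t, HasDerivAt (fun t => sin t / (C + cos t))
      (cos t * (C + cos t)⁻¹ + sin t ^ 2 * ((C + cos t)⁻¹) ^ 2) t := by
    intro t
    refine HasDerivAt.congr_deriv ((Real.hasDerivAt_sin t).div (dD t) (hD t).ne') ?_
    have := (hD t).ne'
    field_simp
    ring
  have dL : ∀ t, HasDerivAt (fun t => (t - 2 * Real.arctan (sin t / (C + S + cos t))) / S)
      ((C + cos t)⁻¹) t := by
    intro t
    have h1 := ((Real.hasDerivAt_sin t).div (dE t) (hE t).ne').arctan
    refine HasDerivAt.congr_deriv (((hasDerivAt_id t).sub (h1.const_mul 2)).div_const S) ?_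
    have hd := hD t
    have he := hE t
    have hsc := Real.sin_sq_add_cos_sq t
    have hden : 1 + (sin t / (C + S + cos t)) ^ 2
        = 2 * (C + S) * (C + cos t) / (C + S + cos t) ^ 2 := by
      field_simp
      linear_combination hsc - hCS
    have hnum : cos t * (C + S + cos t) - sin t * -sin t = (C + S) * cos t + 1 := by
      linear_combination hsc
    simp only [Pi.div_apply]
    rw [hden, hnum]
    have : 0 < C + S := by linarith
    field_simp
    linear_combination hCS
  have hS0 := hS.ne'
  have e0 : ∀ t, C * (C + cos t)⁻¹ = 1 - cos t * (C + cos t)⁻¹ := by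
    intro t; have := (hD t).ne'; field_simp; ring
  have hsc : ∀ t, sin t ^ 2 = 1 - cos t ^ 2 := fun t => by linarith [Real.sin_sq_add_cos_sq t]
  constructor
  · rw [ftc _ (fun t => -κ * (sin t / (C + cos t)) + 2 * ((C * (sin t / (C + cos t)) -
      (t - 2 * Real.arctan (sin t / (C + S + cos t))) / S) / S ^ 2))]
    · simp
      field_simp
      ring
    · intro t
      refine HasDerivAt.congr_deriv (((dZ t).const_mul (-κ)).add
        (((((dZ t).const_mul C).sub (dL t)).div_const (S ^ 2)).const_mul 2)) ?_
      have := (hD t).ne'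
      rw [hsc t, show S ^ 2 = C ^ 2 - 1 by linarith]
      have : C ^ 2 - 1 ≠ 0 := by nlinarith
      field_simp
      ring
    · fun_prop
  · rw [ftc _ (fun t => -κ * (-S ^ 2 * ((t - 2 * Real.arctan (sin t / (C + S + cos t))) / S)
        + 2 * C * t - C * (sin t / (C + cos t))
        - C ^ 2 * ((t - 2 * Real.arctan (sin t / (C + S + cos t))) / S))
        + (4 * t - 4 * C * ((t - 2 * Real.arctan (sin t / (C + S + cos t))) / S)
        - 2 * (sin t / (C + cos t))))]
    · simp
      field_simp
      ring
    · intro t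
      refine HasDerivAt.congr_deriv (((((((dL t).const_mul (-S ^ 2)).add
        ((hasDerivAt_id t).const_mul (2 * C))).sub ((dZ t).const_mul C)).sub
        ((dL t).const_mul (C ^ 2))).const_mul (-κ)).add
        ((((hasDerivAt_id t).const_mul 4).sub ((dL t).const_mul (4 * C))).sub
          ((dZ t).const_mul 2))) ?_
      have := (hD t).ne'
      rw [hsc t, show S ^ 2 = C ^ 2 - 1 by linarith]
      field_simp
      ring
    · fun_prop

lemma bdry_vals (R μ δ : ℝ) (hR : 0 < R) (hδ : 0 < δ) :
    bdryInt R (ctr2 R δ) μ (h1 R δ) (p1 R δ μ) ψ1 = -(4 * π * μ) * A1 R δ ∧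
    bdryInt R (ctr2 R δ) μ (h1 R δ) (p1 R δ μ) Uex =
      -(8 * π * μ * R) * A1 R δ * sinh (ss R δ) ^ 3 / cosh (2 * ss R δ) := by
  obtain ⟨ha, haS, hc, hS, hs⟩ := ss_facts R δ hR hδ
  have hCS := Real.cosh_sq (ss R δ)
  have hC1 : 1 < cosh (ss R δ) := Real.one_lt_cosh.2 hs.ne'
  have hcv := fun t => circle_vals R δ μ t hR hδ _ rfl
  have hm' : cosh (2 * ss R δ) = 2 * cosh (ss R δ) ^ 2 - 1 := by
    rw [Real.cosh_two_mul, Real.sinh_sq]; ring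
  rw [hm']
  set A := A1 R δ
  set C := cosh (ss R δ)
  set S := sinh (ss R δ)
  have hm : 0 < 2 * C ^ 2 - 1 := by nlinarith
  have hD : ∀ t, 0 < C + cos t := fun t => by linarith [Real.neg_one_le_cos t]
  obtain ⟨i1, i2⟩ := ints C S (4 * C / (2 * C ^ 2 - 1)) hC1 hS hCS
  constructor
  · calc _ = ∫ t in (0 : ℝ)..(2 * π), (μ * A * S ^ 3) *
        (-(4 * C / (2 * C ^ 2 - 1)) * (cos t * (C + cos t)⁻¹ + sin t ^ 2 * ((C + cos t)⁻¹) ^ 2)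
        + 2 * cos t * ((C + cos t)⁻¹) ^ 2) := by
          unfold bdryInt
          refine intervalIntegral.integral_congr (fun t _ => ?_)
          obtain ⟨c0, c1, c2, c3, c4⟩ := hcv t
          have hd := (hD t).ne'
          have hsc := Real.sin_sq_add_cos_sq t
          simp only [ctr2, ψ1, dot, matVec, stress, strain, grad, zero_add]
          simp [c0, c1, c2, c3, c4]
          have e : ∀ p k μ c s : ℝ, (s ^ 2 + c ^ 2 = 1) →
            (-p + (2 * μ * (2⁻¹ * (k * s * c)) + 2 * μ * (2⁻¹ * (k * s * c)))) * c +
             (2 * μ * (2⁻¹ * (k * s * s)) + -(2 * μ * (2⁻¹ * (k * c * c)))) * s = -p * c + μ * (k * s) := by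
            intro p k μ c s h
            linear_combination (μ * k * s) * h
          rw [e _ _ _ _ _ hsc]
          unfold pval kval
          field_simp
          ring
      _ = _ := by
          rw [intervalIntegral.integral_const_mul, i1]
          field_simp
  · calc _ = ∫ t in (0 : ℝ)..(2 * π), (μ * A * S ^ 3 * R) *
        (-(4 * C / (2 * C ^ 2 - 1)) * (cos t + sin t ^ 2 * cos t * ((C + cos t)⁻¹) ^ 2)
        + 2 * cos t * (C + cos t)⁻¹ - 2 * sin t ^ 2 * ((C + cos t)⁻¹) ^ 2) := by
          unfold bdryInt
          refine intervalIntegral.integral_congr (fun t _ => ?_)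
          obtain ⟨c0, c1, c2, c3, c4⟩ := hcv t
          have hd := (hD t).ne'
          have hsc := Real.sin_sq_add_cos_sq t
          simp only [ctr2, Uex, dot, matVec, stress, strain, grad, zero_add]
          simp [c0, c1, c2, c3, c4]
          rw [hc]
          have e : ∀ p k μ c s x y : ℝ, (s ^ 2 + c ^ 2 = 1) →
            x * ((-p + (2 * μ * (2⁻¹ * (k * s * c)) + 2 * μ * (2⁻¹ * (k * s * c)))) * c +
             (2 * μ * (2⁻¹ * (k * s * s)) + -(2 * μ * (2⁻¹ * (k * c * c)))) * s) +
             -(y * ((-(2 * μ * (2⁻¹ * (k * c * c))) + 2 * μ * (2⁻¹ * (k * s * s))) * c +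
               (-p + (-(2 * μ * (2⁻¹ * (k * c * s))) + -(2 * μ * (2⁻¹ * (k * c * s))))) * s))
              = x * (-p * c + μ * (k * s)) - y * (-p * s - μ * (k * c)) := by
            intro p k μ c s x y h
            linear_combination (μ * k * s * x + y * μ * k * c) * h
          rw [e _ _ _ _ _ _ _ hsc]
          unfold pval kval
          field_simp
          ring
      _ = _ := by
          rw [intervalIntegral.integral_const_mul, i2]
          have key : 2 * π * (4 * C / (2 * C ^ 2 - 1)) * (C - S) ^ 2 / S - 8 * π * (C - S) / S
            = - 8 * π / (2 * C ^ 2 - 1) := by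
            field_simp
            linear_combination (-8 * C) * hCS
          rw [key]
          field_simp

lemma asymp (R δ : ℝ) (hR : 0 < R) (hδ : 0 < δ) (hδ2 : δ < R / 4) :
    |A1 R δ - 3 / 8 * (R / δ) ^ ((3 : ℝ) / 2)| ≤ 4 * √R * δ ^ (-(1 / 2) : ℝ) ∧
    |8 * A1 R δ * sinh (ss R δ) ^ 3 / cosh (2 * ss R δ) - 3| ≤ 69 * (δ / R) := by
  obtain ⟨ha, haS, hc, hS, hs⟩ := ss_facts R δ hR hδ
  set s := ss R δ with hsdef
  have hw2 : (2 * sinh (s / 2)) ^ 2 = δ / R := by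
    have h1 : cosh s = 1 + 2 * sinh (s / 2) ^ 2 := by
      have h := Real.cosh_two_mul (s / 2)
      rw [Real.cosh_sq, show 2 * (s / 2) = s by ring] at h
      rw [h]; ring
    rw [h1] at hc
    field_simp
    linarith
  have hwpos : 0 < 2 * sinh (s / 2) := by
    have := Real.sinh_pos_iff.2 (show 0 < s / 2 by linarith)
    linarith
  set w := 2 * sinh (s / 2) with hw
  have hws : s ≤ w := by
    have := Real.self_le_sinh_iff.2 (show 0 ≤ s / 2 by linarith)
    rw [hw]; linarith
  have hwh : w < 1 / 2 := by
    have : δ / R < 1 / 4 := by rw [div_lt_iff₀ hR]; linarith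
    nlinarith
  have hs1 : s ≤ 1 / 2 := by linarith
  have t1 := tanh_bounds (2 * s) (by linarith) (by linarith)
  have s1 := sinh_bound s hs.le (by linarith)
  have s2 := sinh_bound (s / 2) (by linarith) (by linarith)
  have c1 := cosh_bound (2 * s) (by linarith) (by linarith)
  have c2 := Real.one_le_cosh (2 * s)
  obtain ⟨hT, k1, k2⟩ := core s w (2 * s - tanh (2 * s)) (sinh s) (cosh (2 * s)) hs hs1 hws
    (by rw [hw]; nlinarith [s2.2]) (by nlinarith [t1.2.2]) (by nlinarith [t1.2.1]) s1.1 s1.2 c2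
    (by nlinarith)
  have hwsq : w = √(δ / R) := by rw [← hw2, Real.sqrt_sq hwpos.le]
  have hA : A1 R δ = 1 / (2 * s - tanh (2 * s)) := rfl
  have r1 : (R / δ) ^ ((3 : ℝ) / 2) = 1 / w ^ 3 := by
    have : R / δ = (w⁻¹) ^ 2 := by rw [inv_pow, hw2, inv_div]
    rw [this, ← Real.rpow_natCast, ← Real.rpow_mul (by positivity),
      show ((2 : ℕ) : ℝ) * (3 / 2) = ((3 : ℕ) : ℝ) by norm_num, Real.rpow_natCast]
    simp
  have r2 : 4 * √R * δ ^ (-(1 / 2) : ℝ) = 4 / w := by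
    rw [Real.rpow_neg hδ.le, ← Real.sqrt_eq_rpow, hwsq, Real.sqrt_div hδ.le]
    have := Real.sqrt_pos.2 hδ
    have := Real.sqrt_pos.2 hR
    field_simp
  constructor
  · rw [r1, r2, hA]; exact k1
  · rw [← hw2, hA]
    have : 8 * (1 / (2 * s - tanh (2 * s))) * sinh s ^ 3 / cosh (2 * s)
      = 8 * sinh s ^ 3 / ((2 * s - tanh (2 * s)) * cosh (2 * s)) := by
      have := hT.ne'
      have := (Real.cosh_pos (2 * s)).ne'
      field_simp
    rw [this]; exact k2

end Aux

/-- exact value and asymptotics of `I₁`, asymptotics of `J₁`. -/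
theorem statement10 (R μ : ℝ) (hR : 0 < R) (hμ : 0 < μ) :
    (∀ δ : ℝ, 0 < δ →
      bdryInt R (ctr2 R δ) μ (h1 R δ) (p1 R δ μ) ψ1 =
        -(4 * π * μ) / (2 * ss R δ - Real.tanh (2 * ss R δ))) ∧
    ∃ C > (0 : ℝ), ∃ δ₀ > (0 : ℝ), ∀ δ : ℝ, 0 < δ → δ < δ₀ →
      |bdryInt R (ctr2 R δ) μ (h1 R δ) (p1 R δ μ) ψ1 +
          3 * π * μ / 2 * (R / δ) ^ ((3 : ℝ) / 2)| ≤ C * δ ^ (-(1 / 2) : ℝ) ∧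
      |bdryInt R (ctr2 R δ) μ (h1 R δ) (p1 R δ μ) Uex + 3 * π * μ * R| ≤ C * δ := by
  refine ⟨?_, 16 * π * μ * √R + 69 * π * μ, by positivity, R / 4, by positivity, ?_⟩
  · intro δ hδ
    rw [(bdry_vals R μ δ hR hδ).1, A1]
    ring
  · intro δ hδ hδ2
    obtain ⟨b1, b2⟩ := bdry_vals R μ δ hR hδ
    obtain ⟨a1, a2⟩ := asymp R δ hR hδ hδ2
    have hrp : 0 ≤ δ ^ (-(1 / 2) : ℝ) := Real.rpow_nonneg hδ.le _
    have hpm : 0 < π * μ := by positivity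
    constructor
    · rw [b1, show -(4 * π * μ) * A1 R δ + 3 * π * μ / 2 * (R / δ) ^ ((3 : ℝ) / 2)
        = -(4 * π * μ) * (A1 R δ - 3 / 8 * (R / δ) ^ ((3 : ℝ) / 2)) by ring, abs_mul, abs_neg,
        abs_of_pos (show 0 < 4 * π * μ by positivity)]
      calc _ ≤ 4 * π * μ * (4 * √R * δ ^ (-(1 / 2) : ℝ)) := by gcongr
        _ = (16 * π * μ * √R) * δ ^ (-(1 / 2) : ℝ) := by ring
        _ ≤ _ := by
          apply mul_le_mul_of_nonneg_right _ hrp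
          nlinarith
    · rw [b2, show -(8 * π * μ * R) * A1 R δ * sinh (ss R δ) ^ 3 / cosh (2 * ss R δ) + 3 * π * μ * R
        = -(π * μ * R) * (8 * A1 R δ * sinh (ss R δ) ^ 3 / cosh (2 * ss R δ) - 3) by ring, abs_mul,
        abs_neg, abs_of_pos (show 0 < π * μ * R by positivity)]
      calc _ ≤ π * μ * R * (69 * (δ / R)) := by gcongr
        _ = (69 * π * μ) * δ := by field_simp
        _ ≤ _ := by
          apply mul_le_mul_of_nonneg_right _ hδ.le
          have : 0 ≤ 16 * π * μ * √R := by positivity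
          linarith

end StokesPaper
end
end

section
/- For $s>0$ set $\eta_1=\sinh^2 s/s^2$, $\eta_2=\sinh(2s)/(2s)$, and define for $x>0$: $f_1(x)=\frac{xe^{-x}\sinh x-x^2\eta_2+x^3\eta_1}{\sinh 2x-2x\eta_2}$ and $f_2(x)=\frac{x^2e^{-x}\sinh x-x^3\eta_2+s^2x^2\eta_1}{\sinh 2x-2x\eta_2}$. There exist constants $C>0$ and $s_0>0$ such that for all $0<s<s_0$: (i) for all $x\ge 2s$ and $j=1,2$, $|f_j(x)|+|f_j'(x)|+|f_j''(x)|\le C(1+x^3)e^{-2x}$; (ii) for all $x$ with $2s\le x\le 1$, $|f_1'(x)-\tfrac12|\le Cx$ and $|f_2''(x)-1|\le Cx$. -/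
open Real

noncomputable section

namespace StokesPaper

/-- `η₁(s) = sinh²s / s²`. -/
def η1 (s : ℝ) : ℝ := Real.sinh s ^ 2 / s ^ 2

/-- `η₂(s) = sinh(2s)/(2s)`. -/
def η2 (s : ℝ) : ℝ := Real.sinh (2 * s) / (2 * s)

/-- `f₁(x) = (x e^{-x} sinh x - x² η₂ + x³ η₁)/(sinh 2x - 2x η₂)`. -/
def f1 (s x : ℝ) : ℝ :=
  (x * Real.exp (-x) * Real.sinh x - x ^ 2 * η2 s + x ^ 3 * η1 s) /
    (Real.sinh (2 * x) - 2 * x * η2 s)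

/-- `f₂(x) = (x² e^{-x} sinh x - x³ η₂ + s² x² η₁)/(sinh 2x - 2x η₂)`. -/
def f2 (s x : ℝ) : ℝ :=
  (x ^ 2 * Real.exp (-x) * Real.sinh x - x ^ 3 * η2 s + s ^ 2 * x ^ 2 * η1 s) /
    (Real.sinh (2 * x) - 2 * x * η2 s)


/-- Bounds for the first two derivatives of `P - V / D`. -/
theorem quot_bound (f P P1 P2 V V1 V2 D D1 D2 : ℝ → ℝ)
    (hP : ∀ x, HasDerivAt P (P1 x) x) (hP1 : ∀ x, HasDerivAt P1 (P2 x) x)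
    (hV : ∀ x, HasDerivAt V (V1 x) x) (hV1 : ∀ x, HasDerivAt V1 (V2 x) x)
    (hD : ∀ x, HasDerivAt D (D1 x) x) (hD1 : ∀ x, HasDerivAt D1 (D2 x) x)
    (hf : ∀ x, D x ≠ 0 → f x = P x - V x / D x)
    (x w m K : ℝ) (hw : 0 < w) (hm : 0 ≤ m) (hK : 0 ≤ K) (hDx : 0 < D x)
    (b1 : |D1 x| * w ≤ K * D x) (b2 : |D2 x| * w ^ 2 ≤ K * D x)
    (c0 : |V x| ≤ m * D x) (c1 : |V1 x| * w ≤ m * D x) (c2 : |V2 x| * w ^ 2 ≤ m * D x) :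
    |f x - P x| ≤ m ∧ |deriv f x - P1 x| * w ≤ m * (1 + K) ∧
      |deriv (deriv f) x - P2 x| * w ^ 2 ≤ m * (1 + 3 * K + 2 * K ^ 2) := by
  have hcont : Continuous D := continuous_iff_continuousAt.2 fun x => (hD x).continuousAt
  have hopen : IsOpen {y | D y ≠ 0} := isOpen_ne_fun hcont continuous_const
  have hd1 : ∀ y, D y ≠ 0 → deriv f y = P1 y - (V1 y * D y - V y * D1 y) / D y ^ 2 := by
    intro y hy
    have h := (hP y).sub ((hV y).div (hD y) hy)
    have he : f =ᶠ[nhds y] (P - V / D) := by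
      filter_upwards [hopen.mem_nhds hy] with z hz using hf z hz
    exact (h.congr_of_eventuallyEq he).deriv
  have hd2 : deriv (deriv f) x = P2 x - ((V2 x * D x + V1 x * D1 x - (V1 x * D1 x + V x * D2 x))
      * D x ^ 2 - (V1 x * D x - V x * D1 x) * (2 * D x * D1 x)) / (D x ^ 2) ^ 2 := by
    have hy : D x ≠ 0 := hDx.ne'
    have h := (hP1 x).sub ((((hV1 x).mul (hD x)).sub ((hV x).mul (hD1 x))).div ((hD x).pow 2)
      (pow_ne_zero 2 hy))
    have he : deriv f =ᶠ[nhds x] (P1 - (V1 * D - V * D1) / D ^ 2) := by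
      filter_upwards [hopen.mem_nhds hy] with z hz using hd1 z hz
    rw [(h.congr_of_eventuallyEq he).deriv]
    simp
  have hne := hDx.ne'
  have q0 : |V x / D x| ≤ m := by
    rw [abs_div, abs_of_pos hDx, div_le_iff₀ hDx]; exact c0
  have q1 : |V1 x * w / D x| ≤ m := by
    rw [abs_div, abs_of_pos hDx, div_le_iff₀ hDx, abs_mul, abs_of_pos hw]; exact c1
  have q2 : |V2 x * w ^ 2 / D x| ≤ m := by
    rw [abs_div, abs_of_pos hDx, div_le_iff₀ hDx, abs_mul, abs_of_pos (pow_pos hw 2)]; exact c2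
  have r1 : |D1 x * w / D x| ≤ K := by
    rw [abs_div, abs_of_pos hDx, div_le_iff₀ hDx, abs_mul, abs_of_pos hw]; exact b1
  have r2 : |D2 x * w ^ 2 / D x| ≤ K := by
    rw [abs_div, abs_of_pos hDx, div_le_iff₀ hDx, abs_mul, abs_of_pos (pow_pos hw 2)]; exact b2
  refine ⟨?_, ?_, ?_⟩
  · rw [hf x hne]
    have : P x - V x / D x - P x = -(V x / D x) := by ring
    rw [this, abs_neg]; exact q0
  · rw [hd1 x hne, ← abs_of_pos hw, ← abs_mul]
    have : (P1 x - (V1 x * D x - V x * D1 x) / D x ^ 2 - P1 x) * w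
        = (V x / D x) * (D1 x * w / D x) - V1 x * w / D x := by
      field_simp; ring
    rw [this]
    calc _ ≤ |(V x / D x) * (D1 x * w / D x)| + |V1 x * w / D x| := abs_sub _ _
      _ ≤ m * K + m := by
        rw [abs_mul]; gcongr
      _ = _ := by ring
  · rw [hd2, ← abs_of_pos (pow_pos hw 2), ← abs_mul]
    have : (P2 x - ((V2 x * D x + V1 x * D1 x - (V1 x * D1 x + V x * D2 x))
      * D x ^ 2 - (V1 x * D x - V x * D1 x) * (2 * D x * D1 x)) / (D x ^ 2) ^ 2 - P2 x) * w ^ 2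
        = (V x / D x) * (D2 x * w ^ 2 / D x) + 2 * ((V1 x * w / D x) * (D1 x * w / D x))
          - (V2 x * w ^ 2 / D x
            + 2 * ((V x / D x) * ((D1 x * w / D x) * (D1 x * w / D x)))) := by
      field_simp; ring
    rw [this]
    have t1 : |(V x / D x) * (D2 x * w ^ 2 / D x)| ≤ m * K := by rw [abs_mul]; gcongr
    have t2 : |(V1 x * w / D x) * (D1 x * w / D x)| ≤ m * K := by rw [abs_mul]; gcongr
    have t3 : |(V x / D x) * ((D1 x * w / D x) * (D1 x * w / D x))| ≤ m * (K * K) := by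
      rw [abs_mul, abs_mul]; gcongr
    rw [abs_le] at t1 t2 t3 q2 ⊢
    constructor <;> nlinarith

theorem sinh_taylor (x : ℝ) (hx : 0 < x) (hx1 : x ≤ 1 / 2) :
    ∃ A, |A| ≤ 1 / 2 ∧ sinh (2 * x) = 2 * x + 4 / 3 * x ^ 3 + x ^ 5 * A := by
  refine ⟨(sinh (2 * x) - 2 * x - 4 / 3 * x ^ 3) / x ^ 5, ?_, by field_simp; ring⟩
  rw [abs_div, abs_of_pos (pow_pos hx 5), div_le_iff₀ (pow_pos hx 5)]
  have h1 := Real.exp_bound (x := 2 * x) (by rw [abs_of_pos (by linarith)]; linarith)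
    (n := 5) (by norm_num)
  have h2 := Real.exp_bound (x := -(2 * x)) (by rw [abs_neg, abs_of_pos (by linarith)]; linarith)
    (n := 5) (by norm_num)
  rw [abs_neg] at h2
  rw [abs_of_pos (by linarith : 0 < 2 * x)] at h1 h2
  simp only [Finset.sum_range_succ, Finset.sum_range_zero, Nat.factorial] at h1 h2
  have := pow_pos hx 5
  rw [sinh_eq]
  norm_num at h1 h2
  rw [abs_le] at h1 h2 ⊢
  constructor <;> nlinarith

theorem cosh_taylor (x : ℝ) (hx : 0 < x) (hx1 : x ≤ 1 / 2) :
    ∃ B, |B| ≤ 1 / 2 ∧ cosh (2 * x) = 1 + 2 * x ^ 2 + 2 / 3 * x ^ 4 + x ^ 6 * B := by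
  refine ⟨(cosh (2 * x) - 1 - 2 * x ^ 2 - 2 / 3 * x ^ 4) / x ^ 6, ?_, by field_simp; ring⟩
  rw [abs_div, abs_of_pos (pow_pos hx 6), div_le_iff₀ (pow_pos hx 6)]
  have h1 := Real.exp_bound (x := 2 * x) (by rw [abs_of_pos (by linarith)]; linarith)
    (n := 6) (by norm_num)
  have h2 := Real.exp_bound (x := -(2 * x)) (by rw [abs_neg, abs_of_pos (by linarith)]; linarith)
    (n := 6) (by norm_num)
  rw [abs_neg] at h2
  rw [abs_of_pos (by linarith : 0 < 2 * x)] at h1 h2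
  simp only [Finset.sum_range_succ, Finset.sum_range_zero, Nat.factorial] at h1 h2
  have := pow_pos hx 6
  rw [cosh_eq]
  norm_num at h1 h2
  rw [abs_le] at h1 h2 ⊢
  constructor <;> nlinarith

theorem sinh_sq_half (x : ℝ) : sinh x ^ 2 = (cosh (2 * x) - 1) / 2 := by
  rw [cosh_two_mul, cosh_sq]; ring

theorem exp_sinh (x : ℝ) : exp (-x) * sinh x = (1 - exp (-2 * x)) / 2 := by
  rw [sinh_eq]
  have h : exp (-x) * exp x = 1 := by rw [← exp_add]; simp
  have h2 : exp (-x) * exp (-x) = exp (-2 * x) := by rw [← exp_add]; congr 1; ring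
  rw [← h2]; linear_combination h / 2

theorem exp_neg_two (x : ℝ) : exp (-2 * x) = cosh (2 * x) - sinh (2 * x) := by
  rw [cosh_sub_sinh]; congr 1; ring

theorem eta_expand (s : ℝ) (hs : 0 < s) (hs1 : s ≤ 1 / 2) :
    ∃ A B, |A| ≤ 1 / 2 ∧ |B| ≤ 1 / 2 ∧ η2 s = 1 + 2 / 3 * s ^ 2 + s ^ 4 * A / 2 ∧
      η1 s = 1 + s ^ 2 / 3 + s ^ 4 * B / 2 := by
  obtain ⟨A, hA, h⟩ := sinh_taylor s hs hs1
  obtain ⟨B, hB, h'⟩ := cosh_taylor s hs hs1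
  refine ⟨A, B, hA, hB, ?_, ?_⟩
  · rw [η2, h]; field_simp
    try ring
  · rw [η1, sinh_sq_half, h']; field_simp
    try ring

theorem hD0 (b x : ℝ) : HasDerivAt (fun x => sinh (2 * x) - 2 * x * b) (2 * cosh (2 * x) - 2 * b) x := by
  have h2 : HasDerivAt (fun x : ℝ => 2 * x) 2 x := by simpa using (hasDerivAt_id x).const_mul 2
  exact (h2.sinh.sub (h2.mul_const b)).congr_deriv (by ring)

theorem hs2 (x : ℝ) : HasDerivAt (fun x => sinh (2 * x)) (2 * cosh (2 * x)) x := by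
  have h2 : HasDerivAt (fun x : ℝ => 2 * x) 2 x := by simpa using (hasDerivAt_id x).const_mul 2
  convert h2.sinh using 1
  ring

theorem hc2 (x : ℝ) : HasDerivAt (fun x => cosh (2 * x)) (2 * sinh (2 * x)) x := by
  have h2 : HasDerivAt (fun x : ℝ => 2 * x) 2 x := by simpa using (hasDerivAt_id x).const_mul 2
  convert h2.cosh using 1
  ring

theorem he2 (x : ℝ) : HasDerivAt (fun x => exp (-2 * x)) (-2 * exp (-2 * x)) x := by
  have h2 : HasDerivAt (fun x : ℝ => -2 * x) (-2) x := by simpa using (hasDerivAt_id x).const_mul (-2)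
  convert h2.exp using 1
  ring

theorem hD1 (b x : ℝ) : HasDerivAt (fun x => 2 * cosh (2 * x) - 2 * b) (4 * sinh (2 * x)) x := by
  exact (((hc2 x).const_mul 2).sub_const (2 * b)).congr_deriv (by ring)

theorem hpow (n : ℕ) (x : ℝ) : HasDerivAt (fun x : ℝ => x ^ n) (n * x ^ (n - 1)) x :=
  hasDerivAt_pow n x

theorem abs_pow_mul_le (x Y M : ℝ) (n : ℕ) (hx : 0 < x) (h : |Y| ≤ M) :
    |x ^ n * Y| ≤ M * x ^ n := by
  rw [abs_mul, abs_of_pos (pow_pos hx n), mul_comm]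
  gcongr

theorem eta_rel (s x : ℝ) (hs : 0 < s) (hsx : 2 * s ≤ x) (hx : x ≤ 1 / 2) :
    ∃ e1 e2 k, |e1| ≤ 1 ∧ |e2| ≤ 1 / 4 ∧ |k| ≤ 1 ∧ η1 s = 1 + x ^ 2 * e1 ∧
      η2 s = 1 + x ^ 2 * e2 ∧ s ^ 2 * η1 s = 3 / 2 * (η2 s - 1) - x ^ 4 * k := by
  obtain ⟨A, B, hA, hB, h2, h1⟩ := eta_expand s hs (by linarith)
  have hx0 : 0 < x := by linarith
  obtain ⟨r, hr⟩ : ∃ r, r = s / x := ⟨_, rfl⟩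
  have hr0 : 0 ≤ r := by rw [hr]; positivity
  have hr1 : r ≤ 1 / 2 := by rw [hr, div_le_iff₀ hx0]; linarith
  have hsr : s = r * x := by rw [hr]; field_simp
  have hr2 : r ^ 2 ≤ 1 / 4 := by nlinarith
  have hr20 : 0 ≤ r ^ 2 := by positivity
  have hs2 : s ^ 2 ≤ 1 / 16 := by nlinarith
  have hs20 : 0 ≤ s ^ 2 := by positivity
  rw [abs_le] at hA hB
  refine ⟨r ^ 2 * (1 / 3 + s ^ 2 * B / 2), r ^ 2 * (2 / 3 + s ^ 2 * A / 2),
    r ^ 4 * (3 / 4 * A - 1 / 3 - s ^ 2 * B / 2), ?_, ?_, ?_, ?_, ?_, ?_⟩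
  · have : |1 / 3 + s ^ 2 * B / 2| ≤ 1 := by rw [abs_le]; constructor <;> nlinarith
    rw [abs_mul, abs_of_nonneg hr20]; nlinarith [abs_nonneg (1 / 3 + s ^ 2 * B / 2)]
  · have : |2 / 3 + s ^ 2 * A / 2| ≤ 1 := by rw [abs_le]; constructor <;> nlinarith
    rw [abs_mul, abs_of_nonneg hr20]; nlinarith [abs_nonneg (2 / 3 + s ^ 2 * A / 2)]
  · have : |3 / 4 * A - 1 / 3 - s ^ 2 * B / 2| ≤ 1 := by rw [abs_le]; constructor <;> nlinarith
    have h4 : r ^ 4 ≤ 1 := by nlinarith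
    have h40 : 0 ≤ r ^ 4 := by positivity
    rw [abs_mul, abs_of_nonneg h40]
    nlinarith [abs_nonneg (3 / 4 * A - 1 / 3 - s ^ 2 * B / 2)]
  · rw [h1, hsr]; ring
  · rw [h2, hsr]; ring
  · rw [h1, h2, hsr]; ring

theorem den_small (s x : ℝ) (hs : 0 < s) (hsx : 2 * s ≤ x) (hx : x ≤ 1 / 2) :
    x ^ 3 / 2 ≤ sinh (2 * x) - 2 * x * η2 s ∧
    |2 * cosh (2 * x) - 2 * η2 s| * x ≤ 24 * (sinh (2 * x) - 2 * x * η2 s) ∧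
    |4 * sinh (2 * x)| * x ^ 2 ≤ 24 * (sinh (2 * x) - 2 * x * η2 s) := by
  have hx0 : 0 < x := by linarith
  obtain ⟨e1, e2, k, he1, he2, hk, h1, h2, h3⟩ := eta_rel s x hs hsx hx
  obtain ⟨A, hA, hA'⟩ := sinh_taylor x hx0 hx
  obtain ⟨B, hB, hB'⟩ := cosh_taylor x hx0 hx
  have hp : x ^ 2 ≤ 1 / 4 := by nlinarith
  have hp0 : 0 < x ^ 2 := by positivity
  have hp4 : x ^ 4 ≤ 1 / 16 := by nlinarith
  have hp40 : 0 < x ^ 4 := by positivity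
  have hx3 : 0 < x ^ 3 := by positivity
  rw [abs_le] at hA hB he2
  have hlow : x ^ 3 / 2 ≤ sinh (2 * x) - 2 * x * η2 s := by
    have : sinh (2 * x) - 2 * x * η2 s = x ^ 3 * (4 / 3 + x ^ 2 * A - 2 * e2) := by
      rw [hA', h2]; ring
    rw [this]
    have : 1 / 2 ≤ 4 / 3 + x ^ 2 * A - 2 * e2 := by nlinarith
    nlinarith
  refine ⟨hlow, ?_, ?_⟩
  · have : |2 * cosh (2 * x) - 2 * η2 s| ≤ 6 * x ^ 2 := by
      have : 2 * cosh (2 * x) - 2 * η2 s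
          = x ^ 2 * (4 + 4 / 3 * x ^ 2 + 2 * (x ^ 4 * B) - 2 * e2) := by
        rw [hB', h2]; ring
      rw [this]
      apply abs_pow_mul_le _ _ _ _ hx0
      rw [abs_le]; constructor <;> nlinarith
    nlinarith
  · have : |4 * sinh (2 * x)| ≤ 12 * x := by
      have : 4 * sinh (2 * x) = x ^ 1 * (8 + 16 / 3 * x ^ 2 + 4 * (x ^ 4 * A)) := by
        rw [hA']; ring
      rw [this]
      have := abs_pow_mul_le x (8 + 16 / 3 * x ^ 2 + 4 * (x ^ 4 * A)) 12 1 hx0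
        (by rw [abs_le]; constructor <;> nlinarith)
      simpa using this
    nlinarith

theorem num_small (s x : ℝ) (hs : 0 < s) (hsx : 2 * s ≤ x) (hx : x ≤ 1 / 2) :
    (|x * ((cosh (2 * x) - 1) / 2) - x ^ 3 * η1 s| ≤ 16 * x ^ 5 ∧
    |(cosh (2 * x) - 1) / 2 + x * sinh (2 * x) - 3 * x ^ 2 * η1 s| ≤ 16 * x ^ 4 ∧
    |2 * sinh (2 * x) + 2 * x * cosh (2 * x) - 6 * x * η1 s| ≤ 16 * x ^ 3) ∧
    (|x ^ 2 * ((cosh (2 * x) - 1) / 2 - s ^ 2 * η1 s)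
        - 3 / 4 * (x * (sinh (2 * x) - 2 * x * η2 s))| ≤ 30 * x ^ 6 ∧
    |2 * x * ((cosh (2 * x) - 1) / 2 - s ^ 2 * η1 s) + x ^ 2 * sinh (2 * x)
        - 3 / 4 * (sinh (2 * x) + 2 * x * cosh (2 * x) - 4 * x * η2 s)| ≤ 30 * x ^ 5 ∧
    |2 * ((cosh (2 * x) - 1) / 2 - s ^ 2 * η1 s) + x * sinh (2 * x) + 2 * x ^ 2 * cosh (2 * x)
        - 3 * (cosh (2 * x) - η2 s)| ≤ 30 * x ^ 4) := by
  have hx0 : 0 < x := by linarith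
  obtain ⟨e1, e2, k, he1, he2, hk, h1, h2, h3⟩ := eta_rel s x hs hsx hx
  obtain ⟨A, hA, hA'⟩ := sinh_taylor x hx0 hx
  obtain ⟨B, hB, hB'⟩ := cosh_taylor x hx0 hx
  have hp : x ^ 2 ≤ 1 / 4 := by nlinarith
  have hp0 : 0 < x ^ 2 := by positivity
  have hp4 : x ^ 4 ≤ 1 / 16 := by nlinarith
  have hp40 : 0 < x ^ 4 := by positivity
  have q1 : |x ^ 2 * A| ≤ 1 / 2 := (abs_pow_mul_le x A _ 2 hx0 hA).trans (by linarith)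
  have q2 : |x ^ 2 * B| ≤ 1 / 2 := (abs_pow_mul_le x B _ 2 hx0 hB).trans (by linarith)
  have q3 : |x ^ 4 * B| ≤ 1 / 2 := (abs_pow_mul_le x B _ 4 hx0 hB).trans (by linarith)
  rw [abs_le] at hA hB he2 he1 hk q1 q2 q3
  refine ⟨⟨?_, ?_, ?_⟩, ⟨?_, ?_, ?_⟩⟩
  · have : x * ((cosh (2 * x) - 1) / 2) - x ^ 3 * η1 s
        = x ^ 5 * (1 / 3 + x ^ 2 * B / 2 - e1) := by rw [hB', h1]; ring
    rw [this]
    exact abs_pow_mul_le _ _ _ _ hx0 (by rw [abs_le]; constructor <;> linarith)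
  · have : (cosh (2 * x) - 1) / 2 + x * sinh (2 * x) - 3 * x ^ 2 * η1 s
        = x ^ 4 * (5 / 3 + x ^ 2 * B / 2 + x ^ 2 * A - 3 * e1) := by rw [hB', hA', h1]; ring
    rw [this]
    exact abs_pow_mul_le _ _ _ _ hx0 (by rw [abs_le]; constructor <;> linarith)
  · have : 2 * sinh (2 * x) + 2 * x * cosh (2 * x) - 6 * x * η1 s
        = x ^ 3 * (20 / 3 + 2 * (x ^ 2 * A) + 4 / 3 * x ^ 2 + 2 * (x ^ 4 * B) - 6 * e1) := by
      rw [hB', hA', h1]; ring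
    rw [this]
    exact (abs_pow_mul_le x _ _ 3 hx0 (by rw [abs_le]; constructor <;> linarith))
  · have : x ^ 2 * ((cosh (2 * x) - 1) / 2 - s ^ 2 * η1 s)
        - 3 / 4 * (x * (sinh (2 * x) - 2 * x * η2 s))
        = x ^ 6 * (1 / 3 + x ^ 2 * B / 2 - 3 / 4 * A + k) := by
      rw [hB', hA', h3]; ring
    rw [this]
    exact abs_pow_mul_le _ _ _ _ hx0 (by rw [abs_le]; constructor <;> linarith)
  · have : 2 * x * ((cosh (2 * x) - 1) / 2 - s ^ 2 * η1 s) + x ^ 2 * sinh (2 * x)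
        - 3 / 4 * (sinh (2 * x) + 2 * x * cosh (2 * x) - 4 * x * η2 s)
        = x ^ 5 * (1 + x ^ 2 * A - 3 / 4 * A - x ^ 2 * B / 2 + 2 * k) := by
      rw [hB', hA', h3]; ring
    rw [this]
    exact abs_pow_mul_le _ _ _ _ hx0 (by rw [abs_le]; constructor <;> linarith)
  · have : 2 * ((cosh (2 * x) - 1) / 2 - s ^ 2 * η1 s) + x * sinh (2 * x)
        + 2 * x ^ 2 * cosh (2 * x) - 3 * (cosh (2 * x) - η2 s)
        = x ^ 4 * (4 + 4 / 3 * x ^ 2 + x ^ 2 * A - 2 * (x ^ 2 * B) + 2 * (x ^ 4 * B)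
          + 2 * k) := by
      rw [hB', hA', h3]; ring
    rw [this]
    exact abs_pow_mul_le _ _ _ _ hx0 (by rw [abs_le]; constructor <;> linarith)

theorem sq_eta1 (s : ℝ) (hs : 0 < s) : s ^ 2 * η1 s = sinh s ^ 2 := by
  rw [η1]; field_simp

theorem hpw (n : ℕ) (c x : ℝ) : HasDerivAt (fun x : ℝ => x ^ n * c) (n * x ^ (n - 1) * c) x :=
  (hasDerivAt_pow n x).mul_const c

theorem small_f1 (s x : ℝ) (hs : 0 < s) (hsx : 2 * s ≤ x) (hx : x ≤ 1 / 2) :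
    |f1 s x - x / 2| ≤ 32 * x ^ 2 ∧ |deriv (f1 s) x - 1 / 2| * x ≤ 32 * x ^ 2 * (1 + 24) ∧
    |deriv (deriv (f1 s)) x - 0| * x ^ 2 ≤ 32 * x ^ 2 * (1 + 3 * 24 + 2 * 24 ^ 2) := by
  have hx0 : 0 < x := by linarith
  obtain ⟨d0, d1, d2⟩ := den_small s x hs hsx hx
  obtain ⟨⟨v0, v1, v2⟩, -⟩ := num_small s x hs hsx hx
  have hx3 : 0 < x ^ 3 := by positivity
  have hx5 : x ^ 5 = x ^ 2 * x ^ 3 := by ring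
  have hm : 16 * x ^ 5 ≤ 32 * x ^ 2 * (sinh (2 * x) - 2 * x * η2 s) := by
    calc 16 * x ^ 5 = 32 * x ^ 2 * (x ^ 3 / 2) := by ring
      _ ≤ _ := by gcongr
  refine quot_bound (f1 s) (fun x => x / 2) (fun _ => 1 / 2) (fun _ => 0)
    (fun x => x * ((cosh (2 * x) - 1) / 2) - x ^ 3 * η1 s)
    (fun x => (cosh (2 * x) - 1) / 2 + x * sinh (2 * x) - 3 * x ^ 2 * η1 s)
    (fun x => 2 * sinh (2 * x) + 2 * x * cosh (2 * x) - 6 * x * η1 s)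
    (fun x => sinh (2 * x) - 2 * x * η2 s) (fun x => 2 * cosh (2 * x) - 2 * η2 s)
    (fun x => 4 * sinh (2 * x)) ?_ ?_ ?_ ?_ (hD0 _) (hD1 _) ?_ x x (32 * x ^ 2) 24 hx0
    (by positivity) (by norm_num) (by show 0 < sinh (2 * x) - 2 * x * η2 s; linarith) d1 d2 ?_ ?_ ?_
  · intro y; exact (hasDerivAt_id y).div_const 2
  · intro y; exact hasDerivAt_const _ _
  · intro y
    exact (((hasDerivAt_id y).mul (((hc2 y).sub_const 1).div_const 2)).sub
      (hpw 3 (η1 s) y)).congr_deriv (by simp)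
  · intro y
    exact (((((hc2 y).sub_const 1).div_const 2).add ((hasDerivAt_id y).mul (hs2 y))).sub
      (((hasDerivAt_pow 2 y).const_mul 3).mul_const (η1 s))).congr_deriv (by simp; ring)
  · intro y hy
    show _ = y / 2 - (y * ((cosh (2 * y) - 1) / 2) - y ^ 3 * η1 s) / (sinh (2 * y) - 2 * y * η2 s)
    replace hy : sinh (2 * y) - 2 * y * η2 s ≠ 0 := hy
    rw [f1, mul_assoc y, exp_sinh, exp_neg_two, eq_sub_iff_add_eq, ← add_div, div_eq_iff hy]
    ring
  · exact v0.trans hm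
  · refine (mul_le_mul_of_nonneg_right v1 hx0.le).trans (le_trans (le_of_eq ?_) hm); ring
  · refine (mul_le_mul_of_nonneg_right v2 (by positivity)).trans (le_trans (le_of_eq ?_) hm); ring

theorem small_f2 (s x : ℝ) (hs : 0 < s) (hsx : 2 * s ≤ x) (hx : x ≤ 1 / 2) :
    |f2 s x - (x ^ 2 / 2 - 3 / 4 * x)| ≤ 60 * x ^ 3 ∧
    |deriv (f2 s) x - (x - 3 / 4)| * x ≤ 60 * x ^ 3 * (1 + 24) ∧
    |deriv (deriv (f2 s)) x - 1| * x ^ 2 ≤ 60 * x ^ 3 * (1 + 3 * 24 + 2 * 24 ^ 2) := by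
  have hx0 : 0 < x := by linarith
  obtain ⟨d0, d1, d2⟩ := den_small s x hs hsx hx
  obtain ⟨-, ⟨v0, v1, v2⟩⟩ := num_small s x hs hsx hx
  have hx3 : 0 < x ^ 3 := by positivity
  have hm : 30 * x ^ 6 ≤ 60 * x ^ 3 * (sinh (2 * x) - 2 * x * η2 s) := by
    calc 30 * x ^ 6 = 60 * x ^ 3 * (x ^ 3 / 2) := by ring
      _ ≤ _ := by gcongr
  refine quot_bound (f2 s) (fun x => x ^ 2 / 2 - 3 / 4 * x) (fun x => x - 3 / 4) (fun _ => 1)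
    (fun x => x ^ 2 * ((cosh (2 * x) - 1) / 2 - s ^ 2 * η1 s)
        - 3 / 4 * (x * (sinh (2 * x) - 2 * x * η2 s)))
    (fun x => 2 * x * ((cosh (2 * x) - 1) / 2 - s ^ 2 * η1 s) + x ^ 2 * sinh (2 * x)
        - 3 / 4 * (sinh (2 * x) + 2 * x * cosh (2 * x) - 4 * x * η2 s))
    (fun x => 2 * ((cosh (2 * x) - 1) / 2 - s ^ 2 * η1 s) + x * sinh (2 * x)
        + 2 * x ^ 2 * cosh (2 * x) - 3 * (cosh (2 * x) - η2 s))
    (fun x => sinh (2 * x) - 2 * x * η2 s) (fun x => 2 * cosh (2 * x) - 2 * η2 s)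
    (fun x => 4 * sinh (2 * x)) ?_ ?_ ?_ ?_ (hD0 _) (hD1 _) ?_ x x (60 * x ^ 3) 24 hx0
    (by positivity) (by norm_num) (by show 0 < sinh (2 * x) - 2 * x * η2 s; linarith) d1 d2 ?_ ?_ ?_
  · intro y
    exact (((hasDerivAt_pow 2 y).div_const 2).sub
      ((hasDerivAt_id y).const_mul (3 / 4))).congr_deriv (by simp)
  · intro y; exact (hasDerivAt_id y).sub_const _
  · intro y
    exact (((hasDerivAt_pow 2 y).mul ((((hc2 y).sub_const 1).div_const 2).sub_const
      (s ^ 2 * η1 s))).sub (((hasDerivAt_id y).mul (hD0 (η2 s) y)).const_mul (3 / 4))).congr_deriv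
      (by simp; ring)
  · intro y
    have h2 : HasDerivAt (fun x : ℝ => 2 * x) 2 y := by simpa using (hasDerivAt_id y).const_mul 2
    have h4 : HasDerivAt (fun x : ℝ => 4 * x) 4 y := by simpa using (hasDerivAt_id y).const_mul 4
    exact (((h2.mul ((((hc2 y).sub_const 1).div_const 2).sub_const
      (s ^ 2 * η1 s))).add ((hasDerivAt_pow 2 y).mul (hs2 y))).sub
      ((((hs2 y).add (h2.mul (hc2 y))).sub (h4.mul_const (η2 s))).const_mul (3 / 4))).congr_deriv
      (by simp; ring)
  · intro y hy
    show _ = (y ^ 2 / 2 - 3 / 4 * y) - (y ^ 2 * ((cosh (2 * y) - 1) / 2 - s ^ 2 * η1 s)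
        - 3 / 4 * (y * (sinh (2 * y) - 2 * y * η2 s))) / (sinh (2 * y) - 2 * y * η2 s)
    replace hy : sinh (2 * y) - 2 * y * η2 s ≠ 0 := hy
    rw [f2, mul_assoc (y ^ 2), exp_sinh, exp_neg_two, eq_sub_iff_add_eq, ← add_div, div_eq_iff hy]
    ring
  · exact v0.trans hm
  · refine (mul_le_mul_of_nonneg_right v1 hx0.le).trans (le_trans (le_of_eq ?_) hm); ring
  · refine (mul_le_mul_of_nonneg_right v2 (by positivity)).trans (le_trans (le_of_eq ?_) hm); ring

theorem eta_bounds (s : ℝ) (hs : 0 < s) (hs1 : s < 1 / 10) :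
    0 ≤ η1 s ∧ η1 s ≤ 2 ∧ 0 ≤ η2 s ∧ η2 s ≤ 101 / 100 := by
  obtain ⟨A, B, hA, hB, h2, h1⟩ := eta_expand s hs (by linarith)
  rw [abs_le] at hA hB
  have hp : s ^ 2 ≤ 1 / 100 := by nlinarith
  have hp4 : s ^ 4 ≤ 1 / 10000 := by nlinarith [sq_nonneg s]
  have : 0 ≤ s ^ 2 := by positivity
  have : 0 ≤ s ^ 4 := by positivity
  rw [h1, h2]
  refine ⟨?_, ?_, ?_, ?_⟩ <;> nlinarith

theorem den_large (s x : ℝ) (hs : 0 < s) (hs1 : s < 1 / 10) (hx : 1 / 2 ≤ x) :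
    exp (2 * x) / 100 ≤ sinh (2 * x) - 2 * x * η2 s ∧
    |2 * cosh (2 * x) - 2 * η2 s| * 1 ≤ 200 * (sinh (2 * x) - 2 * x * η2 s) ∧
    |4 * sinh (2 * x)| * 1 ^ 2 ≤ 200 * (sinh (2 * x) - 2 * x * η2 s) := by
  obtain ⟨-, -, h0, h1⟩ := eta_bounds s hs hs1
  have he : exp (2 * x) = exp 1 * exp (2 * x - 1) := by rw [← exp_add]; congr 1; ring
  have he1 : 2.7 ≤ exp 1 := by have := exp_one_gt_d9; linarith
  have he2 := add_one_le_exp (2 * x - 1)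
  have hE : 2.7 * (2 * x) ≤ exp (2 * x) := by rw [he]; nlinarith
  have hn0 : 0 < exp (-(2 * x)) := exp_pos _
  have hinv : exp (-(2 * x)) * exp (2 * x) = 1 := by rw [← exp_add]; simp
  have hn : exp (-(2 * x)) ≤ 0.4 := by nlinarith
  have hlow : exp (2 * x) / 100 ≤ sinh (2 * x) - 2 * x * η2 s := by
    rw [sinh_eq]; nlinarith
  have hc : 1 ≤ cosh (2 * x) := one_le_cosh _
  refine ⟨hlow, ?_, ?_⟩
  · have : |2 * cosh (2 * x) - 2 * η2 s| ≤ 2 * exp (2 * x) := by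
      rw [cosh_eq] at *
      rw [abs_le]; constructor <;> linarith
    linarith
  · have : |4 * sinh (2 * x)| ≤ 2 * exp (2 * x) := by
      rw [sinh_eq]
      rw [abs_le]; constructor <;> linarith
    linarith

theorem large_m (s x M y : ℝ) (hs : 0 < s) (hs1 : s < 1 / 10) (hx : 1 / 2 ≤ x)
    (hM : 0 ≤ M) (h : |y| ≤ 20 * M) :
    |y| ≤ 2000 * M * exp (-2 * x) * (sinh (2 * x) - 2 * x * η2 s) := by
  obtain ⟨h0, -, -⟩ := den_large s x hs hs1 hx
  have hinv : exp (-2 * x) * exp (2 * x) = 1 := by rw [← exp_add]; simp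
  calc |y| ≤ 20 * M := h
    _ = 2000 * M * exp (-2 * x) * (exp (2 * x) / 100) := by linear_combination (-20 * M) * hinv
    _ ≤ _ := by gcongr

theorem num_large (s x : ℝ) (hs : 0 < s) (hs1 : s < 1 / 10) (hx : 1 / 2 ≤ x) :
    (|-(x * ((1 - exp (-2 * x)) / 2) - x ^ 2 * η2 s + x ^ 3 * η1 s)| ≤ 20 * (1 + x ^ 3) ∧
    |-((1 - exp (-2 * x)) / 2 + x * exp (-2 * x) - 2 * x * η2 s + 3 * x ^ 2 * η1 s)|
      ≤ 20 * (1 + x ^ 3) ∧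
    |-(2 * exp (-2 * x) - 2 * x * exp (-2 * x) - 2 * η2 s + 6 * x * η1 s)|
      ≤ 20 * (1 + x ^ 3)) ∧
    (|-(x ^ 2 * ((1 - exp (-2 * x)) / 2) - x ^ 3 * η2 s + s ^ 2 * x ^ 2 * η1 s)|
      ≤ 20 * (1 + x ^ 3) ∧
    |-(x * (1 - exp (-2 * x)) + x ^ 2 * exp (-2 * x) - 3 * x ^ 2 * η2 s + 2 * s ^ 2 * x * η1 s)|
      ≤ 20 * (1 + x ^ 3) ∧
    |-((1 - exp (-2 * x)) + 4 * x * exp (-2 * x) - 2 * x ^ 2 * exp (-2 * x) - 6 * x * η2 s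
      + 2 * s ^ 2 * η1 s)| ≤ 20 * (1 + x ^ 3)) := by
  obtain ⟨a0, a1, b0, b1⟩ := eta_bounds s hs hs1
  have hE0 : 0 < exp (-2 * x) := exp_pos _
  have hE1 : exp (-2 * x) ≤ 1 := exp_le_one_iff.2 (by linarith)
  generalize exp (-2 * x) = E at *
  generalize η1 s = a at *
  generalize η2 s = b at *
  have hx0 : 0 < x := by linarith
  have hx2 : 0 < x ^ 2 := by positivity
  have hx3 : 0 < x ^ 3 := by positivity
  have i1 : x ≤ 1 + x ^ 3 := by nlinarith [sq_nonneg (x - 1)]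
  have i2 : x ^ 2 ≤ 1 + x ^ 3 := by nlinarith [sq_nonneg (x - 1)]
  have i3 : 6 * x ≤ 5 * (1 + x ^ 3) := by nlinarith [mul_nonneg hx0.le (sq_nonneg (x - 1)), sq_nonneg (x - 1)]
  have bd : ∀ c z M : ℝ, 0 ≤ c → 0 ≤ z → z ≤ M → 0 ≤ c * z ∧ c * z ≤ c * M :=
    fun c z M hc hz hzM => ⟨mul_nonneg hc hz, mul_le_mul_of_nonneg_left hzM hc⟩
  have p1 := bd x E 1 hx0.le hE0.le hE1
  have p2 := bd (x ^ 2) E 1 hx2.le hE0.le hE1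
  have p3 := bd x b _ hx0.le b0 b1
  have p4 := bd (x ^ 2) b _ hx2.le b0 b1
  have p5 := bd (x ^ 3) b _ hx3.le b0 b1
  have p6 := bd x a _ hx0.le a0 a1
  have p7 := bd (x ^ 2) a _ hx2.le a0 a1
  have p8 := bd (x ^ 3) a _ hx3.le a0 a1
  have hs2 : s ^ 2 ≤ 1 := by nlinarith
  have sa0 : 0 ≤ s ^ 2 * a := by positivity
  have sa1 : s ^ 2 * a ≤ 2 := by nlinarith
  have p9 := bd x _ _ hx0.le sa0 sa1
  have p10 := bd (x ^ 2) _ _ hx2.le sa0 sa1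
  simp only [abs_neg]
  refine ⟨⟨?_, ?_, ?_⟩, ⟨?_, ?_, ?_⟩⟩ <;> rw [abs_le] <;> constructor <;> linarith

theorem large_f1 (s x : ℝ) (hs : 0 < s) (hs1 : s < 1 / 10) (hx : 1 / 2 ≤ x) :
    |f1 s x - 0| ≤ 2000 * (1 + x ^ 3) * exp (-2 * x) ∧
    |deriv (f1 s) x - 0| * 1 ≤ 2000 * (1 + x ^ 3) * exp (-2 * x) * (1 + 200) ∧
    |deriv (deriv (f1 s)) x - 0| * 1 ^ 2 ≤
      2000 * (1 + x ^ 3) * exp (-2 * x) * (1 + 3 * 200 + 2 * 200 ^ 2) := by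
  obtain ⟨d0, d1, d2⟩ := den_large s x hs hs1 hx
  obtain ⟨⟨v0, v1, v2⟩, -⟩ := num_large s x hs hs1 hx
  have hx0 : 0 < x := by linarith
  have hM : 0 ≤ 1 + x ^ 3 := by positivity
  have hE := exp_pos (2 * x)
  refine quot_bound (f1 s) (fun x => 0) (fun _ => 0) (fun _ => 0)
    (fun x => -(x * ((1 - exp (-2 * x)) / 2) - x ^ 2 * η2 s + x ^ 3 * η1 s))
    (fun x => -((1 - exp (-2 * x)) / 2 + x * exp (-2 * x) - 2 * x * η2 s + 3 * x ^ 2 * η1 s))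
    (fun x => -(2 * exp (-2 * x) - 2 * x * exp (-2 * x) - 2 * η2 s + 6 * x * η1 s))
    (fun x => sinh (2 * x) - 2 * x * η2 s) (fun x => 2 * cosh (2 * x) - 2 * η2 s)
    (fun x => 4 * sinh (2 * x)) (fun _ => hasDerivAt_const _ _) (fun _ => hasDerivAt_const _ _)
    ?_ ?_ (hD0 _) (hD1 _) ?_ x 1 (2000 * (1 + x ^ 3) * exp (-2 * x)) 200 one_pos
    (by positivity) (by norm_num) (by show 0 < sinh (2 * x) - 2 * x * η2 s; linarith) d1 d2
    (large_m s x _ _ hs hs1 hx hM v0) ?_ ?_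
  · intro y
    exact (((((hasDerivAt_id y).mul (((he2 y).const_sub 1).div_const 2)).sub (hpw 2 (η2 s) y)).add
      (hpw 3 (η1 s) y)).neg).congr_deriv (by simp)
  · intro y
    have h2 : HasDerivAt (fun x : ℝ => 2 * x) 2 y := by simpa using (hasDerivAt_id y).const_mul 2
    exact ((((((he2 y).const_sub 1).div_const 2).add ((hasDerivAt_id y).mul (he2 y))).sub
      (h2.mul_const (η2 s))).add (((hasDerivAt_pow 2 y).const_mul 3).mul_const
      (η1 s))).neg.congr_deriv (by simp; ring)
  · intro y hy
    show _ = 0 - (-(y * ((1 - exp (-2 * y)) / 2) - y ^ 2 * η2 s + y ^ 3 * η1 s)) /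
      (sinh (2 * y) - 2 * y * η2 s)
    rw [f1, mul_assoc y, exp_sinh]; ring
  · rw [mul_one]; exact large_m s x _ _ hs hs1 hx hM v1
  · rw [one_pow, mul_one]; exact large_m s x _ _ hs hs1 hx hM v2

theorem large_f2 (s x : ℝ) (hs : 0 < s) (hs1 : s < 1 / 10) (hx : 1 / 2 ≤ x) :
    |f2 s x - 0| ≤ 2000 * (1 + x ^ 3) * exp (-2 * x) ∧
    |deriv (f2 s) x - 0| * 1 ≤ 2000 * (1 + x ^ 3) * exp (-2 * x) * (1 + 200) ∧
    |deriv (deriv (f2 s)) x - 0| * 1 ^ 2 ≤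
      2000 * (1 + x ^ 3) * exp (-2 * x) * (1 + 3 * 200 + 2 * 200 ^ 2) := by
  obtain ⟨d0, d1, d2⟩ := den_large s x hs hs1 hx
  obtain ⟨-, ⟨v0, v1, v2⟩⟩ := num_large s x hs hs1 hx
  have hx0 : 0 < x := by linarith
  have hM : 0 ≤ 1 + x ^ 3 := by positivity
  have hE := exp_pos (2 * x)
  refine quot_bound (f2 s) (fun x => 0) (fun _ => 0) (fun _ => 0)
    (fun x => -(x ^ 2 * ((1 - exp (-2 * x)) / 2) - x ^ 3 * η2 s + s ^ 2 * x ^ 2 * η1 s))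
    (fun x => -(x * (1 - exp (-2 * x)) + x ^ 2 * exp (-2 * x) - 3 * x ^ 2 * η2 s
      + 2 * s ^ 2 * x * η1 s))
    (fun x => -((1 - exp (-2 * x)) + 4 * x * exp (-2 * x) - 2 * x ^ 2 * exp (-2 * x)
      - 6 * x * η2 s + 2 * s ^ 2 * η1 s))
    (fun x => sinh (2 * x) - 2 * x * η2 s) (fun x => 2 * cosh (2 * x) - 2 * η2 s)
    (fun x => 4 * sinh (2 * x)) (fun _ => hasDerivAt_const _ _) (fun _ => hasDerivAt_const _ _)
    ?_ ?_ (hD0 _) (hD1 _) ?_ x 1 (2000 * (1 + x ^ 3) * exp (-2 * x)) 200 one_pos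
    (by positivity) (by norm_num) (by show 0 < sinh (2 * x) - 2 * x * η2 s; linarith) d1 d2
    (large_m s x _ _ hs hs1 hx hM v0) ?_ ?_
  · intro y
    exact (((((hasDerivAt_pow 2 y).mul (((he2 y).const_sub 1).div_const 2)).sub
      (hpw 3 (η2 s) y)).add (((hasDerivAt_pow 2 y).const_mul (s ^ 2)).mul_const
      (η1 s))).neg).congr_deriv (by simp; ring)
  · intro y
    exact (((((hasDerivAt_id y).mul ((he2 y).const_sub 1)).add ((hasDerivAt_pow 2 y).mul
      (he2 y))).sub (((hasDerivAt_pow 2 y).const_mul 3).mul_const (η2 s))).add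
      (((hasDerivAt_id y).const_mul (2 * s ^ 2)).mul_const (η1 s))).neg.congr_deriv
      (by simp; ring)
  · intro y hy
    show _ = 0 - (-(y ^ 2 * ((1 - exp (-2 * y)) / 2) - y ^ 3 * η2 s + s ^ 2 * y ^ 2 * η1 s)) /
      (sinh (2 * y) - 2 * y * η2 s)
    rw [f2, mul_assoc (y ^ 2), exp_sinh]; ring
  · rw [mul_one]; exact large_m s x _ _ hs hs1 hx hM v1
  · rw [one_pow, mul_one]; exact large_m s x _ _ hs hs1 hx hM v2

theorem small_all (s x : ℝ) (hs : 0 < s) (hsx : 2 * s ≤ x) (hx : x ≤ 1 / 2) :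
    |f1 s x| + |deriv (f1 s) x| + |deriv (deriv (f1 s)) x| ≤ 100000 ∧
    |f2 s x| + |deriv (f2 s) x| + |deriv (deriv (f2 s)) x| ≤ 100000 ∧
    |deriv (f1 s) x - 1 / 2| ≤ 100000 * x ∧ |deriv (deriv (f2 s)) x - 1| ≤ 100000 * x := by
  have hx0 : 0 < x := by linarith
  have hx2 : 0 < x ^ 2 := by positivity
  have hx3 : 0 < x ^ 3 := by positivity
  obtain ⟨a0, a1, a2⟩ := small_f1 s x hs hsx hx
  obtain ⟨b0, b1, b2⟩ := small_f2 s x hs hsx hx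
  have a1' : |deriv (f1 s) x - 1 / 2| ≤ 800 * x := by
    refine le_of_mul_le_mul_right (a1.trans (le_of_eq ?_)) hx0; ring
  have a2' : |deriv (deriv (f1 s)) x - 0| ≤ 39200 := by
    refine le_of_mul_le_mul_right (a2.trans (le_of_eq ?_)) hx2; ring
  have b1' : |deriv (f2 s) x - (x - 3 / 4)| ≤ 1500 * x ^ 2 := by
    refine le_of_mul_le_mul_right (b1.trans (le_of_eq ?_)) hx0; ring
  have b2' : |deriv (deriv (f2 s)) x - 1| ≤ 73500 * x := by
    refine le_of_mul_le_mul_right (b2.trans (le_of_eq ?_)) hx2; ring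
  have h2 : x ^ 2 ≤ 1 / 4 := by nlinarith
  have h3 : x ^ 3 ≤ 1 / 8 := by nlinarith
  have key : ∀ y p c d : ℝ, |y - p| ≤ c → |p| ≤ d → |y| ≤ c + d := by
    intro y p c d h h'
    rw [abs_le] at *
    constructor <;> linarith
  refine ⟨?_, ?_, by linarith, by linarith⟩
  · have k0 := key _ _ _ 1 a0 (by rw [abs_le]; constructor <;> linarith)
    have k1 := key _ _ _ 1 a1' (by rw [abs_le]; constructor <;> linarith)
    have k2 := key _ _ _ 1 a2' (by simp)
    linarith
  · have k0 := key _ _ _ 1 b0 (by rw [abs_le]; constructor <;> linarith)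
    have k1 := key _ _ _ 1 b1' (by rw [abs_le]; constructor <;> linarith)
    have k2 := key _ _ _ 1 b2' (by simp)
    linarith

theorem large_all (s x : ℝ) (hs : 0 < s) (hs1 : s < 1 / 10) (hx : 1 / 2 ≤ x) :
    |f1 s x| + |deriv (f1 s) x| + |deriv (deriv (f1 s)) x| ≤
      200000000 * (1 + x ^ 3) * exp (-2 * x) ∧
    |f2 s x| + |deriv (f2 s) x| + |deriv (deriv (f2 s)) x| ≤
      200000000 * (1 + x ^ 3) * exp (-2 * x) := by
  have hx0 : 0 < x := by linarith
  obtain ⟨a0, a1, a2⟩ := large_f1 s x hs hs1 hx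
  obtain ⟨b0, b1, b2⟩ := large_f2 s x hs hs1 hx
  have hM : 0 < (1 + x ^ 3) * exp (-2 * x) := by positivity
  simp only [sub_zero, mul_one, one_pow] at a0 a1 a2 b0 b1 b2
  constructor <;> linarith
/-- uniform estimates for `f₁, f₂` and their first two derivatives. -/
theorem statement15 :
    ∃ C > (0 : ℝ), ∃ s₀ > (0 : ℝ), ∀ s : ℝ, 0 < s → s < s₀ →
      (∀ x : ℝ, 2 * s ≤ x →
        |f1 s x| + |deriv (f1 s) x| + |deriv (deriv (f1 s)) x| ≤
          C * (1 + x ^ 3) * Real.exp (-2 * x) ∧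
        |f2 s x| + |deriv (f2 s) x| + |deriv (deriv (f2 s)) x| ≤
          C * (1 + x ^ 3) * Real.exp (-2 * x)) ∧
      (∀ x : ℝ, 2 * s ≤ x → x ≤ 1 →
        |deriv (f1 s) x - 1 / 2| ≤ C * x ∧
        |deriv (deriv (f2 s)) x - 1| ≤ C * x) := by
  refine ⟨1000000000, by norm_num, 1 / 10, by norm_num, ?_⟩
  intro s hs hs1
  refine ⟨?_, ?_⟩
  · intro x hsx
    have hx0 : 0 < x := by linarith
    have hx3 : 0 < x ^ 3 := by positivity
    rcases le_total x (1 / 2) with hx | hx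
    · obtain ⟨h1, h2, -, -⟩ := small_all s x hs hsx hx
      have hE : 1 / 3 ≤ Real.exp (-2 * x) := by
        have h : Real.exp (-2 * x) * Real.exp (2 * x) = 1 := by rw [← Real.exp_add]; simp
        have h3 : Real.exp (2 * x) ≤ Real.exp 1 := Real.exp_le_exp.2 (by linarith)
        have h4 := Real.exp_one_lt_d9
        nlinarith [Real.exp_pos (-2 * x)]
      have : 100000 ≤ 1000000000 * (1 + x ^ 3) * Real.exp (-2 * x) := by nlinarith
      exact ⟨h1.trans this, h2.trans this⟩
    · obtain ⟨h1, h2⟩ := large_all s x hs hs1 hx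
      have hM : 0 < (1 + x ^ 3) * Real.exp (-2 * x) := by positivity
      constructor <;> linarith
  · intro x hsx hx1
    have hx0 : 0 < x := by linarith
    rcases le_total x (1 / 2) with hx | hx
    · obtain ⟨-, -, h1, h2⟩ := small_all s x hs hsx hx
      constructor <;> linarith
    · obtain ⟨h1, h2⟩ := large_all s x hs hs1 hx
      have hE0 : 0 < Real.exp (-2 * x) := Real.exp_pos _
      have hE : Real.exp (-2 * x) ≤ 1 := Real.exp_le_one_iff.2 (by linarith)
      have hx3 : x ^ 3 ≤ 1 := pow_le_one₀ hx0.le hx1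
      have hx30 : 0 < x ^ 3 := by positivity
      have hM : (1 + x ^ 3) * Real.exp (-2 * x) ≤ 2 := by nlinarith
      have c1 : |deriv (f1 s) x| ≤ 400000000 := by
        linarith [abs_nonneg (f1 s x), abs_nonneg (deriv (deriv (f1 s)) x)]
      have c2 : |deriv (deriv (f2 s)) x| ≤ 400000000 := by
        linarith [abs_nonneg (f2 s x), abs_nonneg (deriv (f2 s) x)]
      rw [abs_le] at c1 c2
      constructor <;> rw [abs_le] <;> constructor <;> linarith

end StokesPaper
end
end
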